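/- Let P(λ) = Σ_{i=0}^k λ^i A_i be an m×n matrix polynomial of grade k with m > n, let α ≠ 0, and let L̂_t(λ) = λ[[αA_k, X₁₂],[0, −R̃]] + [[Y₁₁, αA₀],[R̃, 0]] be a strong linearization of P(λ), where X₁₂ + Y₁₁ = α[A_{k−1} … A₁] and R̃ ∈ F^{(k−1)n×(k−1)n} is nonsingular upper triangular. Write A(λ) = λ[αA_k X₁₂] + [Y₁₁ αA₀] for the top block of L̂_t. If ΔL̂_t(λ) is any pencil of the same size as L̂_t(λ) with ‖ΔL̂_t‖_F < σ_min(R̃)/(2k^{3/2}), then L̂_t(λ)+ΔL̂_t(λ) is a strong linearization of a matrix polynomial P(λ)+ΔP(λ) of grade k with ‖ΔP‖_F/‖P‖_F ≤ Ĉ · ‖ΔL̂_t‖_F/‖L̂_t‖_F, where Ĉ = (1/|α|)(‖L̂_t‖_F/‖P‖_F)(3 + 2k‖A‖_F/σ_min(R̃)). Moreover, the right minimal indices of L̂_t+ΔL̂_t are those of P+ΔP shifted by k−1 and the left minimal indices of L̂_t+ΔL̂_t are the same as those of P+ΔP, which is the same relationship as that between the minimal indices of L̂_t and P. -/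

import Mathlib

noncomputable section

open Polynomial Matrix

namespace GLin

variable {F : Type*} [RCLike F]

/-! ### Matrix polynomials and pencils -/

/-- The matrix polynomial `P(λ) = ∑_{i=0}^k λ^i A_i` determined by its
coefficient matrices `A_0, …, A_k` (grade `k`). -/
def matPoly {k m n : ℕ} (A : Fin (k + 1) → Matrix (Fin m) (Fin n) F) :
    Matrix (Fin m) (Fin n) F[X] :=
  Matrix.of fun r c => ∑ i : Fin (k + 1), Polynomial.C (A i r c) * Polynomial.X ^ (i : ℕ)

/-- The matrix pencil `L(λ) = λ X + Y`. -/
def pencil {ρ γ : Type*} (Xc Yc : Matrix ρ γ F) : Matrix ρ γ F[X] :=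
  Matrix.of fun i j => Polynomial.C (Xc i j) * Polynomial.X + Polynomial.C (Yc i j)

/-- `Λ_k(λ) ⊗ I_n` where `Λ_k(λ) = (λ^{k-1}, …, λ, 1)ᵀ`. -/
def Lam (F : Type*) [RCLike F] (k n : ℕ) : Matrix (Fin k × Fin n) (Fin n) F[X] :=
  Matrix.of fun p c => if p.2 = c then Polynomial.X ^ (k - 1 - (p.1 : ℕ)) else 0

/-- `Λ_k(λ)ᵀ ⊗ I_m`. -/
def LamRow (F : Type*) [RCLike F] (k m : ℕ) : Matrix (Fin m) (Fin k × Fin m) F[X] :=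
  Matrix.of fun r p => if r = p.2 then Polynomial.X ^ (k - 1 - (p.1 : ℕ)) else 0

/-- `v ⊗ P(λ)`. -/
def vkron {k m n : ℕ} (v : Fin k → F) (P : Matrix (Fin m) (Fin n) F[X]) :
    Matrix (Fin k × Fin m) (Fin n) F[X] :=
  Matrix.of fun p c => Polynomial.C (v p.1) * P p.2 c

/-- `wᵀ ⊗ P(λ)`. -/
def wkron {k m n : ℕ} (w : Fin k → F) (P : Matrix (Fin m) (Fin n) F[X]) :
    Matrix (Fin m) (Fin k × Fin n) F[X] :=
  Matrix.of fun r q => Polynomial.C (w q.1) * P r q.2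

/-- The defining identity of `𝕃₁(P)`: `L(λ)(Λ_k(λ) ⊗ I_n) = v ⊗ P(λ)`. -/
def RightAnsatz {k m n : ℕ} (P : Matrix (Fin m) (Fin n) F[X])
    (L : Matrix (Fin k × Fin m) (Fin k × Fin n) F[X]) (v : Fin k → F) : Prop :=
  L * Lam F k n = vkron v P

/-- The defining identity of `𝕃₂(P)`: `(Λ_k(λ)ᵀ ⊗ I_m) L(λ) = wᵀ ⊗ P(λ)`. -/
def LeftAnsatz {k m n : ℕ} (P : Matrix (Fin m) (Fin n) F[X])
    (L : Matrix (Fin k × Fin m) (Fin k × Fin n) F[X]) (w : Fin k → F) : Prop :=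
  LamRow F k m * L = wkron w P

/-- The vector `α e₁ ∈ F^k`. -/
def e1 {k : ℕ} (α : F) : Fin k → F := fun i => if (i : ℕ) = 0 then α else 0

/-- `M ⊗ I_m`. -/
def kronId {k m : ℕ} (M : Matrix (Fin k) (Fin k) F) :
    Matrix (Fin k × Fin m) (Fin k × Fin m) F :=
  Matrix.of fun p q => if p.2 = q.2 then M p.1 q.1 else 0

/-! ### (strong) g-linearizations -/

/-- `diag(P(λ), I_{k-1} ⊗ I_{m,n})`. -/
def glinTarget {k m n : ℕ} (P : Matrix (Fin m) (Fin n) F[X]) :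
    Matrix (Fin k × Fin m) (Fin k × Fin n) F[X] :=
  Matrix.of fun p q =>
    if p.1 = q.1 then
      (if (p.1 : ℕ) = 0 then P p.2 q.2 else if (p.2 : ℕ) = (q.2 : ℕ) then 1 else 0)
    else 0

/-- A `km × kn` pencil (or matrix polynomial) `L` is a g-linearization of the `m × n`
matrix polynomial `P` of grade `k` if `E(λ) L(λ) G(λ) = diag(P(λ), I_{k-1} ⊗ I_{m,n})`
for unimodular `E`, `G`. -/
def IsGLin {k m n : ℕ} (P : Matrix (Fin m) (Fin n) F[X])
    (L : Matrix (Fin k × Fin m) (Fin k × Fin n) F[X]) : Prop :=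
  ∃ (E : Matrix (Fin k × Fin m) (Fin k × Fin m) F[X])
    (G : Matrix (Fin k × Fin n) (Fin k × Fin n) F[X]),
      IsUnit E.det ∧ IsUnit G.det ∧ E * L * G = glinTarget P

/-- grade-`N` reversal `rev_N P(λ) = λ^N P(1/λ)`, entrywise. -/
def revMat {ρ γ : Type*} (N : ℕ) (P : Matrix ρ γ F[X]) : Matrix ρ γ F[X] :=
  P.map fun p => Polynomial.reflect N p

/-- Strong g-linearization of the grade-`k` matrix polynomial with coefficients `A`. -/
def IsStrongGLin {k m n : ℕ} (A : Fin (k + 1) → Matrix (Fin m) (Fin n) F)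
    (L : Matrix (Fin k × Fin m) (Fin k × Fin n) F[X]) : Prop :=
  IsGLin (matPoly A) L ∧ IsGLin (revMat k (matPoly A)) (revMat 1 L)

/-! ### linearizations (rectangular, of size `(m+s) × (n+s)`) -/

/-- A matrix polynomial `L` (indexed by arbitrary finite types of cardinalities
`m + s` and `n + s`) is a linearization of `P` if, after identifying the index types
with `Fin m ⊕ Fin s` and `Fin n ⊕ Fin s`, one has `E(λ) L(λ) G(λ) = diag(P(λ), I_s)`
for unimodular `E`, `G`. -/
def IsLin {m n : ℕ} (s : ℕ) (P : Matrix (Fin m) (Fin n) F[X])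
    {ρ γ : Type*} [Fintype ρ] [DecidableEq ρ] [Fintype γ] [DecidableEq γ]
    (L : Matrix ρ γ F[X]) : Prop :=
  ∃ (er : ρ ≃ (Fin m ⊕ Fin s)) (ec : γ ≃ (Fin n ⊕ Fin s))
    (E : Matrix (Fin m ⊕ Fin s) (Fin m ⊕ Fin s) F[X])
    (G : Matrix (Fin n ⊕ Fin s) (Fin n ⊕ Fin s) F[X]),
      IsUnit E.det ∧ IsUnit G.det ∧
        E * Matrix.reindex er ec L * G = Matrix.fromBlocks P 0 0 1

/-- Strong linearization of the grade-`k` matrix polynomial with coefficients `A`. -/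
def IsStrongLin {k m n : ℕ} (s : ℕ) (A : Fin (k + 1) → Matrix (Fin m) (Fin n) F)
    {ρ γ : Type*} [Fintype ρ] [DecidableEq ρ] [Fintype γ] [DecidableEq γ]
    (L : Matrix ρ γ F[X]) : Prop :=
  IsLin s (matPoly A) L ∧ IsLin s (revMat k (matPoly A)) (revMat 1 L)

/-! ### shifted sums -/

/-- Column shifted sum `X ⊞→ Y`. -/
def colShiftSum {k m n : ℕ} (Xc Yc : Matrix (Fin k × Fin m) (Fin k × Fin n) F) :
    Matrix (Fin k × Fin m) (Fin (k + 1) × Fin n) F :=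
  Matrix.of fun p q =>
    (if h : (q.1 : ℕ) < k then Xc p (⟨(q.1 : ℕ), h⟩, q.2) else 0) +
    (if h : 0 < (q.1 : ℕ) then
        Yc p (⟨(q.1 : ℕ) - 1, by have := q.1.isLt; omega⟩, q.2)
      else 0)

/-- Row shifted sum `X ⊞↓ Y`. -/
def rowShiftSum {k m n : ℕ} (Xc Yc : Matrix (Fin k × Fin m) (Fin k × Fin n) F) :
    Matrix (Fin (k + 1) × Fin m) (Fin k × Fin n) F :=
  Matrix.of fun p q =>
    (if h : (p.1 : ℕ) < k then Xc (⟨(p.1 : ℕ), h⟩, p.2) q else 0) +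
    (if h : 0 < (p.1 : ℕ) then
        Yc (⟨(p.1 : ℕ) - 1, by have := p.1.isLt; omega⟩, p.2) q
      else 0)

/-! ### the parametrization of `𝕃₁(P)` and `𝕃₂(P)` -/

/-- `X = [v ⊗ A_k ∣ -W]`. -/
def L1X {k m n : ℕ} (A : Fin (k + 1) → Matrix (Fin m) (Fin n) F) (v : Fin k → F)
    (W : Matrix (Fin k × Fin m) (Fin (k - 1) × Fin n) F) :
    Matrix (Fin k × Fin m) (Fin k × Fin n) F :=
  Matrix.of fun p q =>
    if h : (q.1 : ℕ) = 0 then v p.1 * A (Fin.last k) p.2 q.2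
    else -W p (⟨(q.1 : ℕ) - 1, by have := q.1.isLt; omega⟩, q.2)

/-- `Y = [W + v ⊗ [A_{k-1} ⋯ A_1] ∣ v ⊗ A_0]`. -/
def L1Y {k m n : ℕ} (A : Fin (k + 1) → Matrix (Fin m) (Fin n) F) (v : Fin k → F)
    (W : Matrix (Fin k × Fin m) (Fin (k - 1) × Fin n) F) :
    Matrix (Fin k × Fin m) (Fin k × Fin n) F :=
  Matrix.of fun p q =>
    if h : (q.1 : ℕ) < k - 1 then
      W p (⟨(q.1 : ℕ), h⟩, q.2) + v p.1 * A (⟨k - 1 - (q.1 : ℕ), by omega⟩) p.2 q.2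
    else v p.1 * A 0 p.2 q.2

/-- `X = [wᵀ ⊗ A_k ; -Ŵ]`. -/
def L2X {k m n : ℕ} (A : Fin (k + 1) → Matrix (Fin m) (Fin n) F) (w : Fin k → F)
    (W : Matrix (Fin (k - 1) × Fin m) (Fin k × Fin n) F) :
    Matrix (Fin k × Fin m) (Fin k × Fin n) F :=
  Matrix.of fun p q =>
    if h : (p.1 : ℕ) = 0 then w q.1 * A (Fin.last k) p.2 q.2
    else -W (⟨(p.1 : ℕ) - 1, by have := p.1.isLt; omega⟩, p.2) q

/-- `Y = [Ŵ + wᵀ ⊗ [A_{k-1}ᵀ ⋯ A_1ᵀ]ᵀ ; wᵀ ⊗ A_0]`. -/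
def L2Y {k m n : ℕ} (A : Fin (k + 1) → Matrix (Fin m) (Fin n) F) (w : Fin k → F)
    (W : Matrix (Fin (k - 1) × Fin m) (Fin k × Fin n) F) :
    Matrix (Fin k × Fin m) (Fin k × Fin n) F :=
  Matrix.of fun p q =>
    if h : (p.1 : ℕ) < k - 1 then
      W (⟨(p.1 : ℕ), h⟩, p.2) q + w q.1 * A (⟨k - 1 - (p.1 : ℕ), by omega⟩) p.2 q.2
    else w q.1 * A 0 p.2 q.2

/-! ### block structure and `Z`-matrices -/

/-- Assemble a `km × kn` matrix from blocks with row split `m + (k-1)m` and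
column split `n + (k-1)n`. -/
def blk {k m n : ℕ} (TL : Matrix (Fin m) (Fin n) F)
    (TR : Matrix (Fin m) (Fin (k - 1) × Fin n) F)
    (BL : Matrix (Fin (k - 1) × Fin m) (Fin n) F)
    (BR : Matrix (Fin (k - 1) × Fin m) (Fin (k - 1) × Fin n) F) :
    Matrix (Fin k × Fin m) (Fin k × Fin n) F :=
  Matrix.of fun p q =>
    if hp : (p.1 : ℕ) = 0 then
      if hq : (q.1 : ℕ) = 0 then TL p.2 q.2
      else TR p.2 (⟨(q.1 : ℕ) - 1, by have := q.1.isLt; omega⟩, q.2)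
    else
      if hq : (q.1 : ℕ) = 0 then
        BL (⟨(p.1 : ℕ) - 1, by have := p.1.isLt; omega⟩, p.2) q.2
      else
        BR (⟨(p.1 : ℕ) - 1, by have := p.1.isLt; omega⟩, p.2)
          (⟨(q.1 : ℕ) - 1, by have := q.1.isLt; omega⟩, q.2)

/-- Assemble `[[Y₁₁, T],[Z, 0]]`, row split `m + (k-1)m`, column split `(k-1)n + n`. -/
def blkY1 {k m n : ℕ} (Y11 : Matrix (Fin m) (Fin (k - 1) × Fin n) F)
    (T : Matrix (Fin m) (Fin n) F)
    (Z : Matrix (Fin (k - 1) × Fin m) (Fin (k - 1) × Fin n) F) :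
    Matrix (Fin k × Fin m) (Fin k × Fin n) F :=
  Matrix.of fun p q =>
    if hp : (p.1 : ℕ) = 0 then
      if hq : (q.1 : ℕ) < k - 1 then Y11 p.2 (⟨(q.1 : ℕ), hq⟩, q.2) else T p.2 q.2
    else
      if hq : (q.1 : ℕ) < k - 1 then
        Z (⟨(p.1 : ℕ) - 1, by have := p.1.isLt; omega⟩, p.2) (⟨(q.1 : ℕ), hq⟩, q.2)
      else 0

/-- Assemble `[[Y₁₁, Z],[T, 0]]`, row split `(k-1)m + m`, column split `n + (k-1)n`. -/
def blkY2 {k m n : ℕ} (Y11 : Matrix (Fin (k - 1) × Fin m) (Fin n) F)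
    (Z : Matrix (Fin (k - 1) × Fin m) (Fin (k - 1) × Fin n) F)
    (T : Matrix (Fin m) (Fin n) F) :
    Matrix (Fin k × Fin m) (Fin k × Fin n) F :=
  Matrix.of fun p q =>
    if hp : (p.1 : ℕ) < k - 1 then
      if hq : (q.1 : ℕ) = 0 then Y11 (⟨(p.1 : ℕ), hp⟩, p.2) q.2
      else Z (⟨(p.1 : ℕ), hp⟩, p.2) (⟨(q.1 : ℕ) - 1, by have := q.1.isLt; omega⟩, q.2)
    else
      if hq : (q.1 : ℕ) = 0 then T p.2 q.2 else 0

/-- The `Z`-matrix of `L = λX + Y ∈ 𝕃₁(P)` with respect to `M`: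
the lower-left `(k-1)m × (k-1)n` block of `(M ⊗ I_m) Y`. -/
def Zmat1 {k m n : ℕ} (M : Matrix (Fin k) (Fin k) F)
    (Yc : Matrix (Fin k × Fin m) (Fin k × Fin n) F) :
    Matrix (Fin (k - 1) × Fin m) (Fin (k - 1) × Fin n) F :=
  Matrix.of fun p q =>
    (kronId M * Yc : Matrix (Fin k × Fin m) (Fin k × Fin n) F)
      (⟨(p.1 : ℕ) + 1, by have := p.1.isLt; omega⟩, p.2)
      (⟨(q.1 : ℕ), by have := q.1.isLt; omega⟩, q.2)

/-- The `Z`-matrix of `L = λX + Y ∈ 𝕃₂(P)` with respect to `M̂`: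
the upper-right `(k-1)m × (k-1)n` block of `Y (M̂ᵀ ⊗ I_n)`. -/
def Zmat2 {k m n : ℕ} (M : Matrix (Fin k) (Fin k) F)
    (Yc : Matrix (Fin k × Fin m) (Fin k × Fin n) F) :
    Matrix (Fin (k - 1) × Fin m) (Fin (k - 1) × Fin n) F :=
  Matrix.of fun p q =>
    (Yc * kronId Mᵀ : Matrix (Fin k × Fin m) (Fin k × Fin n) F)
      (⟨(p.1 : ℕ), by have := p.1.isLt; omega⟩, p.2)
      (⟨(q.1 : ℕ) + 1, by have := q.1.isLt; omega⟩, q.2)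

/-- `L = λX + Y ∈ 𝕃₁(P)` with right ansatz vector `v` has full `Z`-rank. -/
def FullZrank1 {k m n : ℕ} (Yc : Matrix (Fin k × Fin m) (Fin k × Fin n) F)
    (v : Fin k → F) : Prop :=
  ∃ (M : Matrix (Fin k) (Fin k) F) (α : F),
    IsUnit M ∧ α ≠ 0 ∧ M.mulVec v = e1 α ∧ (Zmat1 M Yc).rank = (k - 1) * n

/-- `L = λX + Y ∈ 𝕃₂(P)` with left ansatz vector `w` has full `Z`-rank. -/
def FullZrank2 {k m n : ℕ} (Yc : Matrix (Fin k × Fin m) (Fin k × Fin n) F)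
    (w : Fin k → F) : Prop :=
  ∃ (M : Matrix (Fin k) (Fin k) F) (α : F),
    IsUnit M ∧ α ≠ 0 ∧ M.mulVec w = e1 α ∧ (Zmat2 M Yc).rank = (k - 1) * m

/-! ### null spaces, minimal bases and minimal indices over `F(λ)` -/

/-- A matrix polynomial viewed as a matrix over the field of rational functions. -/
def matRF {ρ γ : Type*} (P : Matrix ρ γ F[X]) : Matrix ρ γ (RatFunc F) :=
  P.map (algebraMap F[X] (RatFunc F))

/-- The right null space `N_r(P) = {x(λ) : P(λ) x(λ) ≡ 0}` over `F(λ)`. -/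
def Nr {ρ γ : Type*} [Fintype γ] (P : Matrix ρ γ F[X]) :
    Submodule (RatFunc F) (γ → RatFunc F) :=
  LinearMap.ker (Matrix.mulVecLin (matRF P))

/-- The left null space `N_l(P) = {y(λ) : y(λ)ᵀ P(λ) ≡ 0}` over `F(λ)`. -/
def Nl {ρ γ : Type*} [Fintype ρ] (P : Matrix ρ γ F[X]) :
    Submodule (RatFunc F) (ρ → RatFunc F) :=
  Nr Pᵀ

/-- The normal rank of a matrix polynomial: its rank over `F(λ)`. -/
def nrank {ρ γ : Type*} [Fintype γ] (P : Matrix ρ γ F[X]) : ℕ :=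
  (matRF P).rank

/-- The rational vector determined by a vector polynomial. -/
def polyVec {γ : Type*} (x : γ → F[X]) : γ → RatFunc F :=
  fun i => algebraMap F[X] (RatFunc F) (x i)

/-- A rational vector is a vector polynomial if all its entries are polynomials. -/
def IsVecPoly {γ : Type*} (x : γ → RatFunc F) : Prop :=
  ∃ p : γ → F[X], x = polyVec p

/-- The degree of a vector polynomial: the greatest degree of its components. -/
def polyVecDeg {γ : Type*} [Fintype γ] (x : γ → F[X]) : ℕ :=
  Finset.univ.sup fun i => (x i).natDegree

/-- A polynomial basis of the subspace `V` of `F(λ)^γ`. -/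
def IsPolyBasis {γ ι : Type*} [Fintype γ]
    (V : Submodule (RatFunc F) (γ → RatFunc F)) (b : ι → γ → F[X]) : Prop :=
  LinearIndependent (RatFunc F) (fun i => polyVec (b i)) ∧
    Submodule.span (RatFunc F) (Set.range fun i => polyVec (b i)) = V

/-- A minimal basis of `V`: a polynomial basis of least order (sum of degrees). -/
def IsMinimalBasis {γ ι : Type*} [Fintype γ] [Fintype ι]
    (V : Submodule (RatFunc F) (γ → RatFunc F)) (b : ι → γ → F[X]) : Prop :=
  IsPolyBasis V b ∧
    ∀ (d : ℕ) (b' : Fin d → γ → F[X]), IsPolyBasis V b' →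
      ∑ i, polyVecDeg (b i) ≤ ∑ i, polyVecDeg (b' i)

/-- `ε` is the list of minimal indices of `V`: some minimal basis of `V` has
`ε` as its list of degrees. -/
def HasMinIndices {γ : Type*} [Fintype γ]
    (V : Submodule (RatFunc F) (γ → RatFunc F)) {d : ℕ} (ε : Fin d → ℕ) : Prop :=
  ∃ b : Fin d → γ → F[X], IsMinimalBasis V b ∧ ∀ i, polyVecDeg (b i) = ε i

/-- `Λ_k(λ) ⊗ x(λ)`. -/
def lamTensor {n : ℕ} (k : ℕ) (x : Fin n → RatFunc F) : Fin k × Fin n → RatFunc F :=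
  fun p => algebraMap F[X] (RatFunc F) (Polynomial.X ^ (k - 1 - (p.1 : ℕ))) * x p.2

/-- The matrix `vᵀ ⊗ I_m` over `F(λ)`; `𝓛_v(y) = (vproj v).mulVec y`. -/
def vproj {k m : ℕ} (v : Fin k → F) : Matrix (Fin m) (Fin k × Fin m) (RatFunc F) :=
  Matrix.of fun r p =>
    if r = p.2 then algebraMap F[X] (RatFunc F) (Polynomial.C (v p.1)) else 0

/-- `(vᵀ ⊗ I_m) y` at the level of vector polynomials. -/
def LvPoly {k m : ℕ} (v : Fin k → F) (y : Fin k × Fin m → F[X]) : Fin m → F[X] :=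
  fun r => ∑ i : Fin k, Polynomial.C (v i) * y (i, r)

/-- The rational subspace spanned by the rows of a matrix polynomial. -/
def rowSpan {ρ γ : Type*} [Fintype γ] (B : Matrix ρ γ F[X]) :
    Submodule (RatFunc F) (γ → RatFunc F) :=
  Submodule.span (RatFunc F) (Set.range fun i => polyVec (B i))

/-- A matrix polynomial is a minimal basis if its rows form a minimal basis of the
rational subspace they span. -/
def IsMinimalBasisMat {ρ γ : Type*} [Fintype ρ] [Fintype γ] (B : Matrix ρ γ F[X]) : Prop :=
  IsMinimalBasis (rowSpan B) (fun i => B i)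

/-- Dual minimal bases: `B ∈ F[λ]^{n₁×n}`, `C ∈ F[λ]^{n₂×n}` minimal bases with
`n₁ + n₂ = n` and `B Cᵀ = 0`. -/
def DualMinBases {ρ ρ' γ : Type*} [Fintype ρ] [Fintype ρ'] [Fintype γ]
    (B : Matrix ρ γ F[X]) (Cm : Matrix ρ' γ F[X]) : Prop :=
  IsMinimalBasisMat B ∧ IsMinimalBasisMat Cm ∧
    Fintype.card ρ + Fintype.card ρ' = Fintype.card γ ∧ B * Cmᵀ = 0

/-! ### norms, singular values -/

/-- Square of the Frobenius norm of a constant matrix. -/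
def frobSq {ρ γ : Type*} [Fintype ρ] [Fintype γ] (Ac : Matrix ρ γ F) : ℝ :=
  ∑ i, ∑ j, ‖Ac i j‖ ^ 2

/-- `‖λX + Y‖_F = sqrt(‖X‖_F² + ‖Y‖_F²)`. -/
def penFrob {ρ γ : Type*} [Fintype ρ] [Fintype γ] (Xc Yc : Matrix ρ γ F) : ℝ :=
  Real.sqrt (frobSq Xc + frobSq Yc)

/-- `‖P‖_F = sqrt(∑ ‖A_i‖_F²)` for `P(λ) = ∑ λ^i A_i`. -/
def famFrob {k m n : ℕ} (A : Fin (k + 1) → Matrix (Fin m) (Fin n) F) : ℝ :=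
  Real.sqrt (∑ i, frobSq (A i))

/-- `‖P‖_F` for a matrix polynomial of grade `g`. -/
def mpolyFrob {ρ γ : Type*} [Fintype ρ] [Fintype γ] (g : ℕ) (P : Matrix ρ γ F[X]) : ℝ :=
  Real.sqrt (∑ i, ∑ j, ∑ d ∈ Finset.range (g + 1), ‖(P i j).coeff d‖ ^ 2)

/-- Square of the Euclidean norm of a vector. -/
def vecNormSq {ι : Type*} [Fintype ι] (x : ι → F) : ℝ := ∑ i, ‖x i‖ ^ 2

/-- The smallest singular value of a matrix. -/
def sigmaMin {ρ γ : Type*} [Fintype ρ] [Fintype γ] (Ac : Matrix ρ γ F) : ℝ :=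
  if Fintype.card γ ≤ Fintype.card ρ then
    sInf {r : ℝ | ∃ x : γ → F, vecNormSq x = 1 ∧ r = Real.sqrt (vecNormSq (Ac.mulVec x))}
  else
    sInf {r : ℝ | ∃ y : ρ → F, vecNormSq y = 1 ∧ r = Real.sqrt (vecNormSq (Acᴴ.mulVec y))}

/-- The spectral norm (2-norm) of a matrix. -/
def norm2 {ρ γ : Type*} [Fintype ρ] [Fintype γ] (Ac : Matrix ρ γ F) : ℝ :=
  sSup {r : ℝ | ∃ x : γ → F, vecNormSq x = 1 ∧ r = Real.sqrt (vecNormSq (Ac.mulVec x))}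

/-- `κ₂(D) = ‖D‖₂ ‖D⁻¹‖₂`. -/
def cond2 {ρ : Type*} [Fintype ρ] [DecidableEq ρ] (Dc : Matrix ρ ρ F) : ℝ :=
  norm2 Dc * norm2 Dc⁻¹

/-! ### pencils used in the backward error analysis -/

/-- `B(λ) = λ [0 ∣ -R̃] + [R̃ ∣ 0]`, i.e. `R̃ (H_{k-1}(λ) ⊗ I_n)` up to sign conventions. -/
def Bpencil {k n : ℕ} (R : Matrix (Fin (k - 1) × Fin n) (Fin (k - 1) × Fin n) F) :
    Matrix (Fin (k - 1) × Fin n) (Fin k × Fin n) F[X] :=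
  Matrix.of fun p q =>
    (if h : (q.1 : ℕ) < k - 1 then Polynomial.C (R p (⟨(q.1 : ℕ), h⟩, q.2)) else 0) +
    (if h : 0 < (q.1 : ℕ) then
        Polynomial.X *
          Polynomial.C (-R p (⟨(q.1 : ℕ) - 1, by have := q.1.isLt; omega⟩, q.2))
      else 0)

/-- The coefficient of `λ` in `H_{k-1}(λ) ⊗ I_n`. -/
def Hlam (F : Type*) [RCLike F] (k n : ℕ) :
    Matrix (Fin (k - 1) × Fin n) (Fin k × Fin n) F :=
  Matrix.of fun p q => if p.2 = q.2 ∧ (q.1 : ℕ) = (p.1 : ℕ) + 1 then 1 else 0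

/-- The constant coefficient of `H_{k-1}(λ) ⊗ I_n`. -/
def Hconst (F : Type*) [RCLike F] (k n : ℕ) :
    Matrix (Fin (k - 1) × Fin n) (Fin k × Fin n) F :=
  Matrix.of fun p q => if p.2 = q.2 ∧ (q.1 : ℕ) = (p.1 : ℕ) then -1 else 0

/-- The convolution matrix `C_j(λ Xc + Yc)` of a pencil, with `j+1` block columns. -/
def convPencil {ρ γ : Type*} (Xc Yc : Matrix ρ γ F) (j : ℕ) :
    Matrix (Fin (j + 2) × ρ) (Fin (j + 1) × γ) F :=
  Matrix.of fun r c =>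
    if (r.1 : ℕ) = (c.1 : ℕ) then Xc r.2 c.2
    else if (r.1 : ℕ) = (c.1 : ℕ) + 1 then Yc r.2 c.2 else 0

/-- λ-coefficient of the trimmed pencil `L̂_t(λ)`:
`[[α A_k, X₁₂],[0, -R̃]]` with row split `m + (k-1)n`. -/
def LtX {k m n : ℕ} (α : F) (Ak : Matrix (Fin m) (Fin n) F)
    (X12 : Matrix (Fin m) (Fin (k - 1) × Fin n) F)
    (R : Matrix (Fin (k - 1) × Fin n) (Fin (k - 1) × Fin n) F) :
    Matrix (Fin m ⊕ (Fin (k - 1) × Fin n)) (Fin k × Fin n) F :=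
  Matrix.of fun s q =>
    Sum.elim
      (fun r => if h : (q.1 : ℕ) = 0 then α * Ak r q.2
        else X12 r (⟨(q.1 : ℕ) - 1, by have := q.1.isLt; omega⟩, q.2))
      (fun p => if h : (q.1 : ℕ) = 0 then 0
        else -R p (⟨(q.1 : ℕ) - 1, by have := q.1.isLt; omega⟩, q.2)) s

/-- Constant coefficient of the trimmed pencil `L̂_t(λ)`:
`[[Y₁₁, α A₀],[R̃, 0]]` with row split `m + (k-1)n`. -/
def LtY {k m n : ℕ} (α : F) (A0 : Matrix (Fin m) (Fin n) F)
    (Y11 : Matrix (Fin m) (Fin (k - 1) × Fin n) F)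
    (R : Matrix (Fin (k - 1) × Fin n) (Fin (k - 1) × Fin n) F) :
    Matrix (Fin m ⊕ (Fin (k - 1) × Fin n)) (Fin k × Fin n) F :=
  Matrix.of fun s q =>
    Sum.elim
      (fun r => if h : (q.1 : ℕ) < k - 1 then Y11 r (⟨(q.1 : ℕ), h⟩, q.2)
        else α * A0 r q.2)
      (fun p => if h : (q.1 : ℕ) < k - 1 then R p (⟨(q.1 : ℕ), h⟩, q.2) else 0) s

/-! ### trimming -/

/-- The rows `[0 ∣ Q₂*] (M ⊗ I_m)`. -/
def bottomRows {k m n c : ℕ} (M : Matrix (Fin k) (Fin k) F)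
    (Q : Matrix (Fin (k - 1) × Fin m) ((Fin (k - 1) × Fin n) ⊕ Fin c) F) :
    Matrix (Fin c) (Fin k × Fin m) F :=
  (Matrix.of fun (j : Fin c) (p : Fin k × Fin m) =>
      if h : (p.1 : ℕ) = 0 then 0
      else star (Q (⟨(p.1 : ℕ) - 1, by have := p.1.isLt; omega⟩, p.2) (Sum.inr j)))
    * kronId M

/-- The square matrix `[D ; [0 ∣ Q₂*](M ⊗ I_m)]` whose invertibility makes `D` admissible. -/
def trimAux {k m n c : ℕ} (M : Matrix (Fin k) (Fin k) F)
    (Q : Matrix (Fin (k - 1) × Fin m) ((Fin (k - 1) × Fin n) ⊕ Fin c) F)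
    (D : Matrix (Fin m ⊕ (Fin (k - 1) × Fin n)) (Fin k × Fin m) F) :
    Matrix ((Fin m ⊕ (Fin (k - 1) × Fin n)) ⊕ Fin c) (Fin k × Fin m) F :=
  Matrix.of (Sum.elim (fun i j => D i j) (fun i j => bottomRows M Q i j))

/-- The columns `(M̂ᵀ ⊗ I_n) [0 ; Q₂]`. -/
def rightCols {k m n c : ℕ} (M : Matrix (Fin k) (Fin k) F)
    (Q : Matrix (Fin (k - 1) × Fin n) ((Fin (k - 1) × Fin m) ⊕ Fin c) F) :
    Matrix (Fin k × Fin n) (Fin c) F :=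
  kronId Mᵀ *
    (Matrix.of fun (q : Fin k × Fin n) (j : Fin c) =>
      if h : (q.1 : ℕ) = 0 then 0
      else Q (⟨(q.1 : ℕ) - 1, by have := q.1.isLt; omega⟩, q.2) (Sum.inr j))

/-- The square matrix `[D̂ ∣ (M̂ᵀ ⊗ I_n)[0 ; Q₂]]` whose invertibility makes `D̂` admissible. -/
def trimAux2 {k m n c : ℕ} (M : Matrix (Fin k) (Fin k) F)
    (Q : Matrix (Fin (k - 1) × Fin n) ((Fin (k - 1) × Fin m) ⊕ Fin c) F)
    (D : Matrix (Fin k × Fin n) (Fin n ⊕ (Fin (k - 1) × Fin m)) F) :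
    Matrix (Fin k × Fin n) ((Fin n ⊕ (Fin (k - 1) × Fin m)) ⊕ Fin c) F :=
  Matrix.of fun q s => Sum.elim (fun t => D q t) (fun j => rightCols M Q q j) s

section Norms

open scoped Matrix.Norms.Frobenius

variable {ρ ρ' γ γ' κ : Type*} [Fintype ρ] [Fintype ρ'] [Fintype γ] [Fintype γ'] [Fintype κ]

lemma frobSq_eq_norm_sq (M : Matrix ρ γ F) : frobSq M = ‖M‖ ^ 2 := by
  have h : (0 : ℝ) ≤ ∑ i, ∑ j, ‖M i j‖ ^ 2 := by positivity
  rw [frobSq, frobenius_norm_def, ← Real.rpow_natCast, ← Real.rpow_mul (by positivity)]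
  simp

lemma penFrob_eq_norm (M N : Matrix ρ γ F) : penFrob M N = ‖fromRows M N‖ := by
  rw [penFrob, ← Real.sqrt_sq (norm_nonneg (fromRows M N)), ← frobSq_eq_norm_sq]
  simp [frobSq, Fintype.sum_sum_type]

lemma penFrob_nonneg (M N : Matrix ρ γ F) : 0 ≤ penFrob M N := Real.sqrt_nonneg _

lemma penFrob_sq (M N : Matrix ρ γ F) : penFrob M N ^ 2 = ‖M‖ ^ 2 + ‖N‖ ^ 2 := by
  rw [penFrob, frobSq_eq_norm_sq, frobSq_eq_norm_sq, Real.sq_sqrt (by positivity)]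

lemma penFrob_add_le (M N M' N' : Matrix ρ γ F) :
    penFrob (M + M') (N + N') ≤ penFrob M N + penFrob M' N' := by
  simp only [penFrob_eq_norm]
  refine le_trans (le_of_eq ?_) (norm_add_le _ _)
  congr 1
  ext (i | i) j <;> simp

lemma penFrob_mul_le (M N : Matrix ρ γ F) (W : Matrix γ γ' F) :
    penFrob (M * W) (N * W) ≤ penFrob M N * ‖W‖ := by
  simp only [penFrob_eq_norm, ← fromRows_mul]
  exact frobenius_norm_mul _ _

lemma norm_right_le_penFrob (M N : Matrix ρ γ F) : ‖N‖ ≤ penFrob M N := by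
  have := penFrob_sq M N
  exact abs_le_of_sq_le_sq' (by nlinarith [sq_nonneg ‖M‖]) (penFrob_nonneg M N) |>.2

lemma norm_submatrix_le (M : Matrix ρ γ F) {f : ρ' → ρ} {g : γ' → γ}
    (hf : Function.Injective f) (hg : Function.Injective g) : ‖M.submatrix f g‖ ≤ ‖M‖ := by
  classical
  refine (abs_le_of_sq_le_sq' ?_ (norm_nonneg _)).2
  rw [← frobSq_eq_norm_sq, ← frobSq_eq_norm_sq]
  simp only [frobSq, submatrix_apply]
  calc ∑ i, ∑ j, ‖M (f i) (g j)‖ ^ 2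
      = ∑ i ∈ Finset.univ.map ⟨f, hf⟩, ∑ j ∈ Finset.univ.map ⟨g, hg⟩, ‖M i j‖ ^ 2 := by
        simp
    _ ≤ ∑ i ∈ Finset.univ.map ⟨f, hf⟩, ∑ j, ‖M i j‖ ^ 2 := by
        refine Finset.sum_le_sum fun i _ => ?_
        exact Finset.sum_le_sum_of_subset_of_nonneg (Finset.subset_univ _) fun _ _ _ => by positivity
    _ ≤ _ := Finset.sum_le_sum_of_subset_of_nonneg (Finset.subset_univ _)
        fun _ _ _ => by positivity

lemma penFrob_submatrix_le (M N : Matrix ρ γ F) {f : ρ' → ρ} (hf : Function.Injective f) :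
    penFrob (M.submatrix f id) (N.submatrix f id) ≤ penFrob M N := by
  refine (abs_le_of_sq_le_sq' ?_ (penFrob_nonneg _ _)).2
  rw [penFrob_sq, penFrob_sq]
  have h1 := norm_submatrix_le M hf (Function.injective_id (α := γ))
  have h2 := norm_submatrix_le N hf (Function.injective_id (α := γ))
  gcongr

lemma isUnit_one_add_of_norm_lt_one [DecidableEq ρ] (M : Matrix ρ ρ F) (h : ‖M‖ < 1) :
    IsUnit (1 + M) := by
  have : CompleteSpace (Matrix ρ ρ F) := FiniteDimensional.complete F _
  have := (Units.oneSub (-M) (by simpa using h)).isUnit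
  simpa using this

lemma vecNormSq_nonneg (x : ρ → F) : 0 ≤ vecNormSq x := by unfold vecNormSq; positivity

lemma vecNormSq_smul (c : F) (x : ρ → F) : vecNormSq (c • x) = ‖c‖ ^ 2 * vecNormSq x := by
  simp [vecNormSq, Finset.mul_sum, mul_pow]

lemma sigmaMin_nonneg (R : Matrix ρ ρ F) : 0 ≤ sigmaMin R := by
  rw [sigmaMin, if_pos le_rfl]
  apply Real.sInf_nonneg
  rintro r ⟨x, -, rfl⟩
  positivity

lemma sigmaMin_sq_mul_le (R : Matrix ρ ρ F) (x : ρ → F) :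
    sigmaMin R ^ 2 * vecNormSq x ≤ vecNormSq (R.mulVec x) := by
  rcases (vecNormSq_nonneg x).eq_or_lt with h0 | hpos
  · rw [← h0, mul_zero]; exact vecNormSq_nonneg _
  set N := Real.sqrt (vecNormSq x) with hN
  have hNpos : 0 < N := Real.sqrt_pos.2 hpos
  have hNsq : N ^ 2 = vecNormSq x := Real.sq_sqrt hpos.le
  have hnorm : ‖((N⁻¹ : ℝ) : F)‖ ^ 2 = (N ^ 2)⁻¹ := by
    rw [RCLike.norm_ofReal, sq_abs, inv_pow]
  have hle : sigmaMin R ≤ Real.sqrt (vecNormSq (R.mulVec (((N⁻¹ : ℝ) : F) • x))) := by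
    rw [sigmaMin, if_pos le_rfl]
    refine csInf_le ⟨0, ?_⟩ ⟨_, ?_, rfl⟩
    · rintro r ⟨y, -, rfl⟩
      positivity
    · rw [vecNormSq_smul, hnorm, ← hNsq]
      field_simp
  have := pow_le_pow_left₀ (sigmaMin_nonneg R) hle 2
  rw [Real.sq_sqrt (vecNormSq_nonneg _), mulVec_smul, vecNormSq_smul, hnorm] at this
  rw [← hNsq]
  calc sigmaMin R ^ 2 * N ^ 2 ≤ (N ^ 2)⁻¹ * vecNormSq (R *ᵥ x) * N ^ 2 := by gcongr
    _ = _ := by field_simp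

lemma sigmaMin_mul_norm_le (R : Matrix ρ ρ F) (M : Matrix ρ γ F) :
    sigmaMin R * ‖M‖ ≤ ‖R * M‖ := by
  refine (abs_le_of_sq_le_sq' ?_ (norm_nonneg _)).2
  have hcols (B : Matrix ρ γ F) : frobSq B = ∑ j, vecNormSq fun i => B i j := Finset.sum_comm
  rw [mul_pow, ← frobSq_eq_norm_sq, ← frobSq_eq_norm_sq, hcols, hcols, Finset.mul_sum]
  exact Finset.sum_le_sum fun j _ => sigmaMin_sq_mul_le R fun i => M i j

lemma sigmaMin_mul_penFrob_le (R : Matrix ρ ρ F) (M N : Matrix ρ γ F) :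
    sigmaMin R * penFrob M N ≤ penFrob (R * M) (R * N) := by
  refine (abs_le_of_sq_le_sq' ?_ (penFrob_nonneg _ _)).2
  have h0 := sigmaMin_nonneg R
  have h1 := pow_le_pow_left₀ (by positivity) (sigmaMin_mul_norm_le R M) 2
  have h2 := pow_le_pow_left₀ (by positivity) (sigmaMin_mul_norm_le R N) 2
  rw [mul_pow, penFrob_sq, penFrob_sq]
  nlinarith

lemma nonempty_of_sigmaMin_pos (R : Matrix ρ ρ F) (h : 0 < sigmaMin R) : Nonempty ρ := by
  by_contra hne
  rw [not_nonempty_iff] at hne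
  rw [sigmaMin, if_pos le_rfl] at h
  simp [vecNormSq] at h

end Norms

section Shift

open scoped Matrix.Norms.Frobenius

variable {ρ : Type*} {K n : ℕ}

/-- The coefficients of `(λX + Y)(Λ_{K+1}(λ) ⊗ I_n)`, highest power of `λ` first. -/
def shiftSum (Xc Yc : Matrix ρ (Fin (K + 1) × Fin n) F) : Matrix ρ (Fin (K + 2) × Fin n) F :=
  Matrix.of fun i s =>
    Fin.lastCases (motive := fun _ => F) 0 (fun q => Xc i (q, s.2)) s.1 +
      Fin.cases (motive := fun _ => F) 0 (fun q => Yc i (q, s.2)) s.1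

lemma shiftSum_zero (Xc Yc : Matrix ρ (Fin (K + 1) × Fin n) F) (i : ρ) (c : Fin n) :
    shiftSum Xc Yc i (0, c) = Xc i (0, c) := by
  have : (0 : Fin (K + 2)) = Fin.castSucc 0 := rfl
  simp only [shiftSum, Matrix.of_apply, Fin.cases_zero, add_zero]
  rw [this, Fin.lastCases_castSucc]

lemma shiftSum_last (Xc Yc : Matrix ρ (Fin (K + 1) × Fin n) F) (i : ρ) (c : Fin n) :
    shiftSum Xc Yc i (Fin.last _, c) = Yc i (Fin.last _, c) := by
  simp only [shiftSum, Matrix.of_apply, Fin.lastCases_last, zero_add]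
  rw [← Fin.succ_last, Fin.cases_succ]

lemma shiftSum_castSucc_succ (Xc Yc : Matrix ρ (Fin (K + 1) × Fin n) F) (i : ρ) (q : Fin K)
    (c : Fin n) :
    shiftSum Xc Yc i (q.succ.castSucc, c) = Xc i (q.succ, c) + Yc i (q.castSucc, c) := by
  simp only [shiftSum, Matrix.of_apply, Fin.lastCases_castSucc]
  rw [← Fin.succ_castSucc, Fin.cases_succ]

/-- Case analysis on an index of `shiftSum`: first, middle or last block. -/
lemma forall_fin_shift {p : Fin (K + 2) → Prop} (h0 : p 0) (hl : p (Fin.last _))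
    (hm : ∀ q : Fin K, p q.succ.castSucc) (s : Fin (K + 2)) : p s := by
  induction s using Fin.lastCases with
  | last => exact hl
  | cast s =>
    induction s using Fin.cases with
    | zero => exact h0
    | succ q => exact hm q

lemma shiftSum_add (Xc Yc Xc' Yc' : Matrix ρ (Fin (K + 1) × Fin n) F) :
    shiftSum (Xc + Xc') (Yc + Yc') = shiftSum Xc Yc + shiftSum Xc' Yc' := by
  ext i ⟨s, c⟩
  induction s using forall_fin_shift <;>
    simp only [shiftSum_zero, shiftSum_last, shiftSum_castSucc_succ, Matrix.add_apply]
  ring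

lemma shiftSum_smul (a : F) (Xc Yc : Matrix ρ (Fin (K + 1) × Fin n) F) :
    shiftSum (a • Xc) (a • Yc) = a • shiftSum Xc Yc := by
  ext i ⟨s, c⟩
  induction s using forall_fin_shift <;>
    simp only [shiftSum_zero, shiftSum_last, shiftSum_castSucc_succ, Matrix.smul_apply, smul_add]

lemma mul_shiftSum {ρ' : Type*} [Fintype ρ] (R : Matrix ρ' ρ F)
    (Xc Yc : Matrix ρ (Fin (K + 1) × Fin n) F) :
    shiftSum (R * Xc) (R * Yc) = R * shiftSum Xc Yc := by
  ext i ⟨s, c⟩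
  induction s using forall_fin_shift <;>
    simp only [shiftSum_zero, shiftSum_last, shiftSum_castSucc_succ, Matrix.mul_apply, mul_add,
      Finset.sum_add_distrib]

lemma norm_shiftSum_le [Fintype ρ] (Xc Yc : Matrix ρ (Fin (K + 1) × Fin n) F) :
    ‖shiftSum Xc Yc‖ ≤ Real.sqrt 2 * penFrob Xc Yc := by
  refine (abs_le_of_sq_le_sq' ?_ (mul_nonneg (Real.sqrt_nonneg _) (penFrob_nonneg _ _))).2
  rw [mul_pow, penFrob_sq, Real.sq_sqrt zero_le_two, ← frobSq_eq_norm_sq, ← frobSq_eq_norm_sq,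
    ← frobSq_eq_norm_sq]
  simp only [frobSq, ← Finset.sum_add_distrib, Finset.mul_sum (s := (Finset.univ : Finset ρ))]
  refine Finset.sum_le_sum fun i _ => ?_
  have hadd (a b : F) : ‖a + b‖ ^ 2 ≤ 2 * (‖a‖ ^ 2 + ‖b‖ ^ 2) := by
    have := norm_add_le a b
    nlinarith [sq_nonneg (‖a‖ - ‖b‖), norm_nonneg (a + b)]
  calc ∑ s, ‖shiftSum Xc Yc i s‖ ^ 2
      ≤ ∑ s : Fin (K + 2) × Fin n, 2 *
        (‖Fin.lastCases (motive := fun _ => F) 0 (fun q => Xc i (q, s.2)) s.1‖ ^ 2 +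
          ‖Fin.cases (motive := fun _ => F) 0 (fun q => Yc i (q, s.2)) s.1‖ ^ 2) :=
        Finset.sum_le_sum fun s _ => hadd _ _
    _ = _ := by
        rw [← Finset.mul_sum, Finset.sum_add_distrib, Fintype.sum_prod_type, Fintype.sum_prod_type,
          Fin.sum_univ_castSucc, Fin.sum_univ_succ (n := K + 1), Finset.sum_add_distrib,
          Fintype.sum_prod_type, Fintype.sum_prod_type]
        simp

end Shift

section Diagonal

open scoped Matrix.Norms.Frobenius

/-- A solution `w` of `w p (s - 1) - w (p + 1) s = g p s` for `p < K`, `s ≤ K + 1`, where `w`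
vanishes for `s = -1` and `s = K + 1`; obtained by summation along the diagonals. -/
def diagSol (K : ℕ) (g : ℕ → ℕ → F) (p s : ℕ) : F :=
  if s ≤ p then -∑ t ∈ Finset.range (min (s + 1) p), g (p - 1 - t) (s - t)
  else ∑ t ∈ Finset.range (K + 1 - s), g (p + t) (s + 1 + t)

lemma diagSol_zero (K : ℕ) (g : ℕ → ℕ → F) (p : ℕ) : diagSol K g (p + 1) 0 = -g p 0 := by
  simp [diagSol]

lemma diagSol_last {K p : ℕ} (g : ℕ → ℕ → F) (hp : p < K) : diagSol K g p K = g p (K + 1) := by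
  simp [diagSol, hp.not_ge]

lemma diagSol_sub {K s : ℕ} (g : ℕ → ℕ → F) (p : ℕ) (hs : s < K) :
    diagSol K g p s - diagSol K g (p + 1) (s + 1) = g p (s + 1) := by
  by_cases h : s ≤ p
  · have hmin : min (s + 1 + 1) (p + 1) = min (s + 1) p + 1 := by omega
    simp only [diagSol, h, add_le_add_iff_right, if_true, hmin]
    rw [Finset.sum_range_succ' _ (min (s + 1) p)]
    have hsum : ∑ t ∈ Finset.range (min (s + 1) p), g (p + 1 - 1 - (t + 1)) (s + 1 - (t + 1)) =
        ∑ t ∈ Finset.range (min (s + 1) p), g (p - 1 - t) (s - t) :=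
      Finset.sum_congr rfl fun t _ => by
        rw [show p + 1 - 1 - (t + 1) = p - 1 - t by omega, Nat.add_sub_add_right]
    rw [hsum]
    simp
  · have hK : K + 1 - s = (K + 1 - (s + 1)) + 1 := by omega
    simp only [diagSol, h, add_le_add_iff_right, if_false]
    rw [hK, Finset.sum_range_succ']
    simp only [add_zero, add_assoc, add_comm (1 : ℕ), add_sub_cancel_left]

lemma norm_sum_range_sq_le (N : ℕ) (f : ℕ → F) :
    ‖∑ t ∈ Finset.range N, f t‖ ^ 2 ≤ N * ∑ t ∈ Finset.range N, ‖f t‖ ^ 2 := by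
  calc ‖∑ t ∈ Finset.range N, f t‖ ^ 2 ≤ (∑ t ∈ Finset.range N, ‖f t‖) ^ 2 := by
        gcongr
        exact norm_sum_le _ _
    _ ≤ _ := by simpa using sq_sum_le_card_mul_sum_sq (s := Finset.range N) (f := fun t => ‖f t‖)

lemma sum_sigma_le_of_injOn {f : ℕ × ℕ → ℝ} (hf : ∀ x, 0 ≤ f x) (s : Finset ℕ) (N : ℕ → ℕ)
    (e : (Σ _ : ℕ, ℕ) → ℕ × ℕ) (he : Set.InjOn e (s.sigma fun i => Finset.range (N i)))
    (T : Finset (ℕ × ℕ)) (hT : ∀ i ∈ s, ∀ t < N i, e ⟨i, t⟩ ∈ T) :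
    ∑ i ∈ s, ∑ t ∈ Finset.range (N i), f (e ⟨i, t⟩) ≤ ∑ x ∈ T, f x := by
  rw [Finset.sum_sigma' s (fun i => Finset.range (N i)) fun i t => f (e ⟨i, t⟩),
    ← Finset.sum_image (f := f) he]
  refine Finset.sum_le_sum_of_subset_of_nonneg ?_ fun x _ _ => hf x
  intro x hx
  obtain ⟨⟨i, t⟩, hit, rfl⟩ := Finset.mem_image.1 hx
  rw [Finset.mem_sigma] at hit
  exact hT i hit.1 t (by simpa using hit.2)

lemma sum_diagSol_row_le {K p : ℕ} (hp : p ≤ K) (g : ℕ → ℕ → F) :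
    ∑ s ∈ Finset.range (K + 1), ‖diagSol K g p s‖ ^ 2 ≤
      p * ∑ x ∈ Finset.range K ×ˢ Finset.range (K + 2) with x.2 ≤ x.1 + 1, ‖g x.1 x.2‖ ^ 2 +
      ((K - p : ℕ) : ℝ) *
        ∑ x ∈ Finset.range K ×ˢ Finset.range (K + 2) with ¬ x.2 ≤ x.1 + 1, ‖g x.1 x.2‖ ^ 2 := by
  rw [← Finset.sum_filter_add_sum_filter_not _ fun s => s ≤ p]
  refine add_le_add ?_ ?_
  · calc _ ≤ ∑ s ∈ Finset.range (K + 1) with s ≤ p, (p : ℝ) *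
          ∑ t ∈ Finset.range (min (s + 1) p), ‖g (p - 1 - t) (s - t)‖ ^ 2 := by
          refine Finset.sum_le_sum fun s hs => ?_
          rw [diagSol, if_pos (Finset.mem_filter.1 hs).2, norm_neg]
          refine (norm_sum_range_sq_le _ _).trans ?_
          gcongr
          omega
      _ ≤ _ := by
          rw [← Finset.mul_sum]
          gcongr
          refine sum_sigma_le_of_injOn (f := fun x => ‖g x.1 x.2‖ ^ 2) (fun _ => by positivity) _ _
            (fun x => (p - 1 - x.2, x.1 - x.2)) ?_ _ ?_
          · rintro ⟨s, t⟩ h ⟨s', t'⟩ h' heq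
            simp only [Finset.coe_sigma, Set.mem_sigma_iff, Finset.coe_filter, Finset.mem_range,
              Set.mem_ofPred_eq, Finset.coe_range, Set.mem_Iio, Prod.mk.injEq] at h h' heq
            obtain rfl : t = t' := by omega
            obtain rfl : s = s' := by omega
            rfl
          · intro s hs t ht
            simp only [Finset.mem_filter, Finset.mem_range, Finset.mem_product] at hs ⊢
            omega
  · calc _ ≤ ∑ s ∈ Finset.range (K + 1) with ¬ s ≤ p, ((K - p : ℕ) : ℝ) *
          ∑ t ∈ Finset.range (K + 1 - s), ‖g (p + t) (s + 1 + t)‖ ^ 2 := by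
          refine Finset.sum_le_sum fun s hs => ?_
          have hs := (Finset.mem_filter.1 hs).2
          rw [diagSol, if_neg hs]
          refine (norm_sum_range_sq_le _ _).trans ?_
          have hcount : K + 1 - s ≤ K - p := by omega
          exact mul_le_mul_of_nonneg_right (by exact_mod_cast hcount) (by positivity)
      _ ≤ _ := by
          rw [← Finset.mul_sum]
          gcongr
          refine sum_sigma_le_of_injOn (f := fun x => ‖g x.1 x.2‖ ^ 2) (fun _ => by positivity) _ _
            (fun x => (p + x.2, x.1 + 1 + x.2)) ?_ _ ?_
          · rintro ⟨s, t⟩ h ⟨s', t'⟩ h' heq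
            simp only [Prod.mk.injEq] at heq
            obtain rfl : t = t' := by omega
            obtain rfl : s = s' := by omega
            rfl
          · intro s hs t ht
            simp only [Finset.mem_filter, Finset.mem_range, Finset.mem_product] at hs ⊢
            omega

lemma sum_diagSol_le (K : ℕ) (g : ℕ → ℕ → F) :
    ∑ p ∈ Finset.range (K + 1), ∑ s ∈ Finset.range (K + 1), ‖diagSol K g p s‖ ^ 2 ≤
      ((K : ℝ) * (K + 1) / 2) *
        ∑ p ∈ Finset.range K, ∑ s ∈ Finset.range (K + 2), ‖g p s‖ ^ 2 := by
  have hsum : ∑ p ∈ Finset.range (K + 1), (p : ℝ) = (K : ℝ) * (K + 1) / 2 := by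
    induction K with
    | zero => simp
    | succ K ih => rw [Finset.sum_range_succ, ih]; push_cast; ring
  have hsum' : ∑ p ∈ Finset.range (K + 1), ((K - p : ℕ) : ℝ) = (K : ℝ) * (K + 1) / 2 := by
    rw [← hsum, ← Finset.sum_range_reflect (fun p : ℕ => (p : ℝ))]
    simp
  refine (Finset.sum_le_sum fun p hp =>
    sum_diagSol_row_le (Nat.lt_succ_iff.1 (Finset.mem_range.1 hp)) g).trans (le_of_eq ?_)
  rw [Finset.sum_add_distrib, ← Finset.sum_mul, ← Finset.sum_mul, hsum, hsum', ← mul_add,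
    Finset.sum_filter_add_sum_filter_not, Finset.sum_product]

variable {K n : ℕ}

/-- The `(c, d)` entries of the blocks of `g`, extended by zero. -/
def extendZero (g : Matrix (Fin K × Fin n) (Fin (K + 2) × Fin n) F) (c d : Fin n) (p s : ℕ) : F :=
  if h : p < K ∧ s < K + 2 then g (⟨p, h.1⟩, c) (⟨s, h.2⟩, d) else 0

/-- A right inverse of `W ↦ shiftSum (H_X W) (H_Y W)` for the pencil `H = λ[0, -I] + [I, 0]`. -/
def diagInv (g : Matrix (Fin K × Fin n) (Fin (K + 2) × Fin n) F) :
    Matrix (Fin (K + 1) × Fin n) (Fin (K + 1) × Fin n) F :=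
  Matrix.of fun p s => diagSol K (extendZero g p.2 s.2) p.1 s.1

lemma diagInv_add (g g' : Matrix (Fin K × Fin n) (Fin (K + 2) × Fin n) F) :
    diagInv (g + g') = diagInv g + diagInv g' := by
  have h (c d : Fin n) (p s : ℕ) :
      extendZero (g + g') c d p s = extendZero g c d p s + extendZero g' c d p s := by
    simp only [extendZero]; split_ifs <;> simp
  ext p s
  simp only [diagInv, Matrix.of_apply, Matrix.add_apply, diagSol, h, Finset.sum_add_distrib]
  split_ifs
  · ring
  · rfl

lemma diagInv_smul (a : F) (g : Matrix (Fin K × Fin n) (Fin (K + 2) × Fin n) F) :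
    diagInv (a • g) = a • diagInv g := by
  have h (c d : Fin n) (p s : ℕ) :
      extendZero (a • g) c d p s = a * extendZero g c d p s := by
    simp only [extendZero]; split_ifs <;> simp
  ext p s
  simp only [diagInv, Matrix.of_apply, Matrix.smul_apply, diagSol, h, ← Finset.mul_sum]
  split_ifs <;> simp

lemma norm_diagInv_le (g : Matrix (Fin K × Fin n) (Fin (K + 2) × Fin n) F) :
    ‖diagInv g‖ ≤ Real.sqrt ((K : ℝ) * (K + 1) / 2) * ‖g‖ := by
  refine (abs_le_of_sq_le_sq' ?_ (by positivity)).2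
  rw [mul_pow, Real.sq_sqrt (by positivity), ← frobSq_eq_norm_sq, ← frobSq_eq_norm_sq]
  have hl : frobSq (diagInv g) = ∑ c, ∑ d, ∑ p ∈ Finset.range (K + 1),
      ∑ s ∈ Finset.range (K + 1), ‖diagSol K (extendZero g c d) p s‖ ^ 2 := by
    simp only [frobSq, Fintype.sum_prod_type, diagInv, Matrix.of_apply, Finset.sum_range]
    rw [Finset.sum_comm]
    refine Finset.sum_congr rfl fun c _ => ?_
    rw [Finset.sum_comm (γ := Fin n)]
    exact Finset.sum_congr rfl fun p _ => Finset.sum_comm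
  have hr : frobSq g = ∑ c, ∑ d, ∑ p ∈ Finset.range K,
      ∑ s ∈ Finset.range (K + 2), ‖extendZero g c d p s‖ ^ 2 := by
    simp only [frobSq, Fintype.sum_prod_type, extendZero, Finset.sum_range]
    rw [Finset.sum_comm]
    refine Finset.sum_congr rfl fun c _ => ?_
    rw [Finset.sum_comm (γ := Fin n)]
    refine Finset.sum_congr rfl fun p _ => ?_
    rw [Finset.sum_comm]
    simp
  rw [hl, hr, Finset.mul_sum]
  refine Finset.sum_le_sum fun c _ => ?_
  rw [Finset.mul_sum]
  exact Finset.sum_le_sum fun d _ => sum_diagSol_le K _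

/-- Multiplication on the left by the coefficient `[0, I]` of `-λ` in `H`. -/
abbrev lowRows {γ : Type*} (W : Matrix (Fin (K + 1) × Fin n) γ F) : Matrix (Fin K × Fin n) γ F :=
  W.submatrix (Prod.map Fin.succ id) id

/-- Multiplication on the left by the constant coefficient `[I, 0]` of `H`. -/
abbrev highRows {γ : Type*} (W : Matrix (Fin (K + 1) × Fin n) γ F) : Matrix (Fin K × Fin n) γ F :=
  W.submatrix (Prod.map Fin.castSucc id) id

lemma shiftSum_diagInv (g : Matrix (Fin K × Fin n) (Fin (K + 2) × Fin n) F) :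
    shiftSum (-lowRows (diagInv g)) (highRows (diagInv g)) = g := by
  ext ⟨p, c⟩ ⟨s, d⟩
  have hext (s : Fin (K + 2)) : extendZero g c d p s = g (p, c) (s, d) := by simp [extendZero]
  rw [← hext]
  induction s using forall_fin_shift with
  | h0 =>
    rw [shiftSum_zero]
    simp [diagInv, diagSol_zero]
  | hl =>
    rw [shiftSum_last]
    simp [diagInv, diagSol_last _ p.2]
  | hm q =>
    rw [shiftSum_castSucc_succ]
    simp only [Matrix.neg_apply, submatrix_apply, Prod.map, id, diagInv, Matrix.of_apply,
      Fin.val_succ, Fin.val_castSucc]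
    have := diagSol_sub (extendZero g c d) p q.2
    rw [← this]
    ring

lemma shiftSum_H_one :
    shiftSum (-lowRows (1 : Matrix (Fin (K + 1) × Fin n) (Fin (K + 1) × Fin n) F))
      (highRows 1) = 0 := by
  ext ⟨p, c⟩ ⟨s, d⟩
  induction s using forall_fin_shift with
  | h0 => simp [shiftSum_zero]
  | hl => simp [shiftSum_last, Fin.ext_iff, p.2.ne]
  | hm q =>
    rw [shiftSum_castSucc_succ]
    simp [Matrix.one_apply]

end Diagonal

section Perturbation

open scoped Matrix.Norms.Frobenius

variable {K n : ℕ}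

lemma lowRows_one_mul {γ : Type*} (W : Matrix (Fin (K + 1) × Fin n) γ F) :
    lowRows (1 : Matrix (Fin (K + 1) × Fin n) (Fin (K + 1) × Fin n) F) * W = lowRows W := by
  ext p s
  simp [Matrix.mul_apply, Matrix.one_apply]

lemma highRows_one_mul {γ : Type*} (W : Matrix (Fin (K + 1) × Fin n) γ F) :
    highRows (1 : Matrix (Fin (K + 1) × Fin n) (Fin (K + 1) × Fin n) F) * W = highRows W := by
  ext p s
  simp [Matrix.mul_apply, Matrix.one_apply]

/-- The coefficient of `λ` in `H = λ[0, -I] + [I, 0]`. -/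
def shiftX (F : Type*) [RCLike F] (K n : ℕ) : Matrix (Fin K × Fin n) (Fin (K + 1) × Fin n) F :=
  -lowRows 1

/-- The constant coefficient of `H = λ[0, -I] + [I, 0]`. -/
def shiftY (F : Type*) [RCLike F] (K n : ℕ) : Matrix (Fin K × Fin n) (Fin (K + 1) × Fin n) F :=
  highRows 1

/-- A small perturbation `H + E` of `H = λ[0, -I] + [I, 0]` annihilates `(I + Δ)(Λ ⊗ I_n)` for
some small constant matrix `Δ`. -/
lemma exists_shiftSum_mul_eq_zero (EX EY : Matrix (Fin K × Fin n) (Fin (K + 1) × Fin n) F) {a : ℝ}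
    (ha : Real.sqrt ((K : ℝ) * (K + 1) / 2) * (Real.sqrt 2 * penFrob EX EY) ≤ a) (ha1 : a < 1) :
    ∃ D : Matrix (Fin (K + 1) × Fin n) (Fin (K + 1) × Fin n) F,
      shiftSum ((shiftX F K n + EX) * (1 + D)) ((shiftY F K n + EY) * (1 + D)) = 0 ∧
        ‖D‖ ≤ a * (1 + ‖D‖) := by
  let T : Matrix (Fin (K + 1) × Fin n) (Fin (K + 1) × Fin n) F →ₗ[F]
      Matrix (Fin (K + 1) × Fin n) (Fin (K + 1) × Fin n) F :=
    { toFun := fun W => diagInv (shiftSum (EX * W) (EY * W))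
      map_add' := fun W W' => by simp only [Matrix.mul_add, shiftSum_add, diagInv_add]
      map_smul' := fun c W => by
        simp only [Matrix.mul_smul, shiftSum_smul, diagInv_smul, RingHom.id_apply] }
  have hbound (MX MY : Matrix (Fin K × Fin n) (Fin (K + 1) × Fin n) F) :
      ‖diagInv (shiftSum MX MY)‖ ≤
        Real.sqrt ((K : ℝ) * (K + 1) / 2) * (Real.sqrt 2 * penFrob MX MY) :=
    (norm_diagInv_le _).trans (by gcongr; exact norm_shiftSum_le _ _)
  have hT (W) : ‖T W‖ ≤ a * ‖W‖ := by
    refine (hbound _ _).trans (le_trans ?_ (mul_le_mul_of_nonneg_right ha (norm_nonneg W)))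
    rw [mul_assoc, mul_assoc (Real.sqrt 2)]
    gcongr
    exact penFrob_mul_le _ _ _
  have hT1 : ‖T 1‖ ≤ a := by
    refine le_trans ?_ ha
    simpa [T] using hbound EX EY
  have hinj : Function.Injective (LinearMap.id + T :
      Matrix (Fin (K + 1) × Fin n) (Fin (K + 1) × Fin n) F →ₗ[F]
        Matrix (Fin (K + 1) × Fin n) (Fin (K + 1) × Fin n) F) := by
    rw [← LinearMap.ker_eq_bot, LinearMap.ker_eq_bot']
    intro W hW
    have h1 : W = -T W := eq_neg_of_add_eq_zero_left hW
    have h2 : ‖W‖ ≤ a * ‖W‖ := by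
      conv_lhs => rw [h1, norm_neg]
      exact hT W
    have h3 : ‖W‖ ≤ 0 := by nlinarith [norm_nonneg W]
    exact norm_le_zero_iff.1 h3
  obtain ⟨D, hD⟩ := LinearMap.surjective_of_injective hinj (-T 1)
  have hD' : D = -T (1 + D) := by
    rw [map_add, neg_add, ← hD]
    simp
  refine ⟨D, ?_, ?_⟩
  · have hHD : shiftSum (-lowRows D) (highRows D) = -shiftSum (EX * (1 + D)) (EY * (1 + D)) := by
      conv_lhs => rw [hD']
      rw [← map_neg]
      change shiftSum (-lowRows (diagInv _)) (highRows (diagInv _)) = _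
      rw [shiftSum_diagInv, Matrix.mul_neg, Matrix.mul_neg, ← neg_one_smul F, ← neg_one_smul F (EY * _),
        shiftSum_smul, neg_one_smul]
    rw [Matrix.add_mul, Matrix.add_mul, shiftSum_add, shiftX, shiftY, Matrix.neg_mul, lowRows_one_mul, highRows_one_mul]
    have h1 : -lowRows (1 + D) = -lowRows 1 + -lowRows D := by
      rw [← neg_add]; rfl
    have h2 : highRows (1 + D) = highRows 1 + highRows D := rfl
    rw [h1, h2, shiftSum_add, shiftSum_H_one, hHD]
    simp
  · conv_lhs => rw [hD', norm_neg, map_add]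
    refine (norm_add_le _ _).trans ?_
    rw [mul_add, mul_one]
    exact add_le_add hT1 (hT D)

lemma sqrt_mul_sqrt_two_mul (K : ℕ) (δ : ℝ) :
    Real.sqrt ((K : ℝ) * (K + 1) / 2) * (Real.sqrt 2 * δ) =
      Real.sqrt K * Real.sqrt (K + 1) * δ := by
  rw [← mul_assoc, ← Real.sqrt_mul (by positivity), ← Real.sqrt_mul (by positivity)]
  congr 2
  ring

/-- Numerical estimate for the fixed point inequality `w ≤ a (1 + w)`. -/
lemma correction_bound {K : ℕ} (hK : 0 < K) {δ w : ℝ} (hδ0 : 0 ≤ δ)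
    (hδ : δ < 1 / (2 * (((K : ℝ) + 1) * Real.sqrt (K + 1))))
    (hw : w ≤ Real.sqrt ((K : ℝ) * (K + 1) / 2) * (Real.sqrt 2 * δ) * (1 + w)) :
    w ≤ Real.sqrt 2 * (K + 1) * δ ∧ w ≤ 1 / 2 ∧ δ ≤ 1 / 5 := by
  have hKr : (1 : ℝ) ≤ K := by exact_mod_cast hK
  rw [sqrt_mul_sqrt_two_mul] at hw
  have hk : (K : ℝ) + 1 = Real.sqrt (K + 1) ^ 2 := (Real.sq_sqrt (by positivity)).symm
  have hy : (K : ℝ) = Real.sqrt K ^ 2 := (Real.sq_sqrt (by positivity)).symm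
  have hq : Real.sqrt 2 ^ 2 = 2 := Real.sq_sqrt zero_le_two
  have hrq : Real.sqrt 2 ≤ Real.sqrt (K + 1) := Real.sqrt_le_sqrt (by linarith)
  have hq0 : 5 / 4 ≤ Real.sqrt 2 := Real.le_sqrt_of_sq_le (by norm_num)
  set r := Real.sqrt (K + 1)
  set y := Real.sqrt K
  set q := Real.sqrt 2
  have hy0 : 0 ≤ y := Real.sqrt_nonneg _
  have hr0 : 0 < r := by linarith
  rw [hk] at hδ ⊢
  have hyr : y ^ 2 = r ^ 2 - 1 := by linarith
  have hδr : 2 * r ^ 3 * δ < 1 := by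
    rw [lt_div_iff₀ (by positivity)] at hδ
    nlinarith
  have hkey : y * (2 * r + q) ≤ 2 * q * r ^ 2 := by
    refine (abs_le_of_sq_le_sq' ?_ (by positivity)).2
    have h1 : (y * (2 * r + q)) ^ 2 = (r ^ 2 - 1) * (4 * r ^ 2 + 4 * r * q + 2) := by
      rw [mul_pow, hyr]; linear_combination (r ^ 2 - 1) * hq
    have h2 : (2 * q * r ^ 2) ^ 2 = 8 * r ^ 4 := by
      rw [mul_pow, mul_pow, hq]; ring
    have h3 : 0 ≤ r ^ 2 * (2 * r - q) ^ 2 := by positivity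
    have h4 : 0 ≤ r * q := by positivity
    have h5 : r ^ 2 * (2 * r - q) ^ 2 = 4 * r ^ 4 - 4 * r ^ 3 * q + 2 * r ^ 2 := by
      linear_combination r ^ 2 * hq
    rw [h1, h2]
    nlinarith
  have hbound : w ≤ q * r ^ 2 * δ := by
    have ha : y * r * δ ≤ (1 - y * r * δ) * (q * r ^ 2 * δ) := by
      have h1 : y * 2 * r ≤ 2 * r * (q * r * (1 - y * r * δ)) := by
        have h2 : y * q * (2 * r ^ 3 * δ) ≤ y * q * 1 := by gcongr
        nlinarith
      have h3 : y ≤ q * r * (1 - y * r * δ) := by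
        refine le_of_mul_le_mul_left ?_ (by positivity : 0 < 2 * r)
        linarith
      calc y * r * δ ≤ q * r * (1 - y * r * δ) * r * δ := by gcongr
        _ = _ := by ring
    have hlt : y * r * δ < 1 := by
      have : y ≤ r := Real.sqrt_le_sqrt (by linarith)
      have h1 : y * r * δ ≤ r * r * δ := by gcongr
      have h2 : r * r * δ ≤ r * r * δ * r := le_mul_of_one_le_right (by positivity) (by linarith)
      nlinarith
    refine le_of_mul_le_mul_left ?_ (by linarith : 0 < 1 - y * r * δ)
    linarith
  refine ⟨hbound, hbound.trans ?_, ?_⟩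
  · have h1 : r * (q * r ^ 2 * δ) ≤ r * (1 / 2) := by nlinarith
    exact le_of_mul_le_mul_left h1 hr0
  · have h1 : 5 / 2 ≤ r ^ 3 := by nlinarith [mul_le_mul hrq hrq (by linarith) (by linarith)]
    nlinarith

lemma correction_coeff_lt_one {K : ℕ} {δ : ℝ} (hδ0 : 0 ≤ δ)
    (hδ : δ < 1 / (2 * (((K : ℝ) + 1) * Real.sqrt (K + 1)))) :
    Real.sqrt ((K : ℝ) * (K + 1) / 2) * (Real.sqrt 2 * δ) < 1 := by
  rw [sqrt_mul_sqrt_two_mul]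
  have hk : Real.sqrt (K + 1) ^ 2 = (K : ℝ) + 1 := Real.sq_sqrt (by positivity)
  have hr : 1 ≤ Real.sqrt ((K : ℝ) + 1) := Real.one_le_sqrt.2 (by simp)
  have hyr : Real.sqrt K ≤ Real.sqrt (K + 1) := Real.sqrt_le_sqrt (by linarith)
  rw [lt_div_iff₀ (by positivity)] at hδ
  set r := Real.sqrt ((K : ℝ) + 1)
  rw [← hk] at hδ
  calc Real.sqrt K * r * δ ≤ r * r * δ := by gcongr
    _ ≤ r * r * δ * r := le_mul_of_one_le_right (by positivity) hr
    _ ≤ δ * (2 * (r ^ 2 * r)) := by nlinarith [pow_pos (zero_lt_one.trans_le hr) 3, mul_nonneg hδ0 (pow_pos (zero_lt_one.trans_le hr) 3).le]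
    _ < 1 := hδ

/-- A perturbation of the pencil `λ[0, -R] + [R, 0]` is brought back to a pencil of the same form
by a constant change of variables close to the identity. -/
lemma exists_restoring (hK : 0 < K) (R : Matrix (Fin K × Fin n) (Fin K × Fin n) F) (hR : IsUnit R)
    (EX EY : Matrix (Fin K × Fin n) (Fin (K + 1) × Fin n) F) (hσ : 0 < sigmaMin R)
    (hE : penFrob EX EY < sigmaMin R / (2 * (((K : ℝ) + 1) * Real.sqrt (K + 1)))) :
    ∃ D : Matrix (Fin (K + 1) × Fin n) (Fin (K + 1) × Fin n) F,
      shiftSum ((R * shiftX F K n + EX) * (1 + D)) ((R * shiftY F K n + EY) * (1 + D)) = 0 ∧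
      ‖D‖ ≤ Real.sqrt 2 * (K + 1) * (penFrob EX EY / sigmaMin R) ∧ ‖D‖ ≤ 1 / 2 ∧
      IsUnit (((R * shiftY F K n + EY) * (1 + D)).submatrix id (Prod.map Fin.castSucc id)) := by
  have hRinv (M : Matrix (Fin K × Fin n) (Fin (K + 1) × Fin n) F) : R * (R⁻¹ * M) = M :=
    Matrix.mul_nonsing_inv_cancel_left _ _ ((Matrix.isUnit_iff_isUnit_det _).1 hR)
  set δ := penFrob (R⁻¹ * EX) (R⁻¹ * EY) with hδdef
  have hδ0 : 0 ≤ δ := penFrob_nonneg _ _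
  have hδE : δ ≤ penFrob EX EY / sigmaMin R := by
    rw [le_div_iff₀ hσ, mul_comm]
    simpa only [hRinv] using sigmaMin_mul_penFrob_le R (R⁻¹ * EX) (R⁻¹ * EY)
  have hδ : δ < 1 / (2 * (((K : ℝ) + 1) * Real.sqrt (K + 1))) := by
    refine hδE.trans_lt ?_
    rw [div_lt_iff₀ hσ, one_div_mul_eq_div]
    exact hE
  obtain ⟨D, hD, hDn⟩ := exists_shiftSum_mul_eq_zero (R⁻¹ * EX) (R⁻¹ * EY) le_rfl
    (correction_coeff_lt_one hδ0 hδ)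
  obtain ⟨h1, h2, h3⟩ := correction_bound hK hδ0 hδ hDn
  have hfac (H E : Matrix (Fin K × Fin n) (Fin (K + 1) × Fin n) F) :
      (R * H + E) * (1 + D) = R * ((H + R⁻¹ * E) * (1 + D)) := by
    rw [← Matrix.mul_assoc, Matrix.mul_add R, hRinv]
  refine ⟨D, ?_, h1.trans (by gcongr), h2, ?_⟩
  · rw [hfac, hfac, mul_shiftSum, hD, Matrix.mul_zero]
  · rw [hfac]
    set N := (highRows D + R⁻¹ * EY + R⁻¹ * EY * D).submatrix id
      (Prod.map Fin.castSucc (id : Fin n → Fin n)) with hN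
    have hsplit : (R * ((shiftY F K n + R⁻¹ * EY) * (1 + D))).submatrix id
        (Prod.map Fin.castSucc id) = R * (1 + N) := by
      have : (shiftY F K n + R⁻¹ * EY) * (1 + D) =
          shiftY F K n + (highRows D + R⁻¹ * EY + R⁻¹ * EY * D) := by
        rw [Matrix.mul_add, Matrix.mul_one, Matrix.add_mul, shiftY, highRows_one_mul]
        abel
      rw [this]
      ext p q
      have hone (r : Fin K × Fin n) :
          (1 : Matrix (Fin (K + 1) × Fin n) (Fin (K + 1) × Fin n) F)
            (Prod.map Fin.castSucc id r) (Prod.map Fin.castSucc id q) = (1 : Matrix _ _ F) r q := by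
        simp [Matrix.one_apply, Prod.ext_iff]
      simp only [Matrix.submatrix_apply, Matrix.mul_apply, id, Matrix.add_apply, ← hone]
      rfl
    rw [hsplit]
    refine hR.mul (isUnit_one_add_of_norm_lt_one _ ?_)
    have hinj : Function.Injective (Prod.map (Fin.castSucc (n := K)) (id : Fin n → Fin n)) :=
      (Fin.castSucc_injective K).prodMap Function.injective_id
    have hb : ‖R⁻¹ * EY‖ ≤ δ := norm_right_le_penFrob _ _
    calc ‖N‖ ≤ ‖highRows D + R⁻¹ * EY + R⁻¹ * EY * D‖ :=
          norm_submatrix_le _ Function.injective_id hinj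
      _ ≤ ‖highRows D‖ + ‖R⁻¹ * EY‖ + ‖R⁻¹ * EY * D‖ := norm_add₃_le
      _ ≤ ‖D‖ + δ + δ * ‖D‖ := by
          gcongr
          · exact norm_submatrix_le _ hinj Function.injective_id
          · exact (frobenius_norm_mul _ _).trans (by gcongr)
      _ < 1 := by nlinarith [norm_nonneg D]

end Perturbation

section Horner

variable {K m n : ℕ}

lemma ite_mul_pow_succ (a : F[X]) (p q : ℕ) :
    (if p ≤ q + 1 then a * X ^ (q + 1 - p) else 0) =
      (if p ≤ q then a * X ^ (q - p) else 0) * X + if p = q + 1 then a else 0 := by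
  rcases lt_trichotomy p (q + 1) with h | h | h
  · have h1 : p ≤ q := by omega
    rw [if_pos h.le, if_pos h1, if_neg h.ne, Nat.succ_sub h1, pow_succ, add_zero, mul_assoc]
  · simp [h]
  · have h1 : ¬ p ≤ q := by omega
    rw [if_neg h.not_ge, if_neg h1, if_neg h.ne', zero_mul, add_zero]

/-- `∑_{p ≤ q} (x_p λ + y_p) λ^{q - p}` in terms of the shifted sum `S` of `x` and `y`. -/
lemma sum_pencil_mul_pow (x y : Fin (K + 1) → F) (S : Fin (K + 2) → F) (h0 : S 0 = x 0)
    (hS : ∀ q : Fin K, S q.succ.castSucc = x q.succ + y q.castSucc) (q : Fin (K + 1)) :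
    ∑ p : Fin (K + 1),
        (if (p : ℕ) ≤ q then (C (x p) * X + C (y p)) * X ^ ((q : ℕ) - p) else 0) =
      C (y q) + ∑ s : Fin (K + 2),
        if (s : ℕ) ≤ q then C (S s) * X * X ^ ((q : ℕ) - s) else (0 : F[X]) := by
  induction q using Fin.induction with
  | zero =>
    have h2 (p : Fin (K + 2)) : (p : ℕ) ≤ (0 : Fin (K + 1)) ↔ p = 0 := by simp
    have h1 (p : Fin (K + 1)) : (p : ℕ) ≤ (0 : Fin (K + 1)) ↔ p = 0 := by simp
    simp only [h1, h2, Finset.sum_ite_eq', Finset.mem_univ, if_true, h0]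
    simp
    ring
  | succ q ih =>
    have h1 (p : Fin (K + 1)) : (p : ℕ) = q + 1 ↔ p = q.succ := by simp [Fin.ext_iff]
    have h2 (p : Fin (K + 2)) : (p : ℕ) = q + 1 ↔ p = q.succ.castSucc := by
      rw [Fin.ext_iff, Fin.val_castSucc, Fin.val_succ]
    simp only [Fin.val_castSucc] at ih
    simp only [Fin.val_succ, ite_mul_pow_succ, Finset.sum_add_distrib, ← Finset.sum_mul, ih, h1, h2,
      Finset.sum_ite_eq', Finset.mem_univ, if_true, hS, map_add]
    ring

/-- The unimodular matrix with blocks `λ^{q - p} I_n` for `p ≤ q`. -/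
def hornerMat (F : Type*) [RCLike F] (K n : ℕ) :
    Matrix (Fin (K + 1) × Fin n) (Fin (K + 1) × Fin n) F[X] :=
  Matrix.kroneckerMap (· * ·)
    (Matrix.of fun p q : Fin (K + 1) => if p ≤ q then (X : F[X]) ^ ((q : ℕ) - p) else 0)
    (1 : Matrix (Fin n) (Fin n) F[X])

lemma det_hornerMat : (hornerMat F K n).det = 1 := by
  rw [hornerMat, det_kronecker, det_one, det_of_isUpperTriangular]
  · simp
  · intro p q hpq
    have : ¬ p ≤ q := not_le.2 hpq
    simp [this]

lemma isUnit_det_mul_hornerMat {W : Matrix (Fin (K + 1) × Fin n) (Fin (K + 1) × Fin n) F}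
    (hW : IsUnit W) : IsUnit (W.map C * hornerMat F K n).det := by
  rw [det_mul, det_hornerMat, mul_one]
  have : (W.map C).det = C W.det := (RingHom.map_det C W).symm
  rw [this]
  exact Polynomial.isUnit_C.2 ((Matrix.isUnit_iff_isUnit_det _).1 hW)

/-- Separate the last block of size `n` from the first `K` ones. -/
def lastBlockEquiv (K n : ℕ) : Fin n ⊕ Fin K × Fin n ≃ Fin (K + 1) × Fin n where
  toFun := Sum.elim (fun c => (Fin.last K, c)) (Prod.map Fin.castSucc id)
  invFun p := Fin.lastCases (motive := fun _ => Fin n ⊕ Fin K × Fin n) (Sum.inl p.2)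
    (fun q => Sum.inr (q, p.2)) p.1
  left_inv := by
    rintro (c | p) <;> simp
  right_inv := by
    rintro ⟨p, c⟩
    induction p using Fin.lastCases <;> simp

lemma pencil_mul_hornerMat {ρ : Type*} (Xc Yc : Matrix ρ (Fin (K + 1) × Fin n) F) (i : ρ)
    (q : Fin (K + 1)) (c : Fin n) :
    (pencil Xc Yc * hornerMat F K n) i (q, c) = C (Yc i (q, c)) + ∑ s : Fin (K + 2),
      if (s : ℕ) ≤ q then C (shiftSum Xc Yc i (s, c)) * X * X ^ ((q : ℕ) - s) else 0 := by
  rw [← sum_pencil_mul_pow (fun p => Xc i (p, c)) (fun p => Yc i (p, c)) _ (shiftSum_zero _ _ _ _)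
    fun q => shiftSum_castSucc_succ _ _ _ _ _]
  rw [Matrix.mul_apply, Fintype.sum_prod_type]
  refine Finset.sum_congr rfl fun p _ => ?_
  simp [hornerMat, pencil, Matrix.one_apply]

/-- The pencil `λX + Y` has the block structure of a trimmed pencil `L̂_t` for the matrix polynomial
with coefficients `A`, up to the shape of the block `R̃`. -/
structure IsTrim (α : F) (A : Fin (K + 1 + 1) → Matrix (Fin m) (Fin n) F)
    (Xc Yc : Matrix (Fin m ⊕ Fin K × Fin n) (Fin (K + 1) × Fin n) F) : Prop where
  top : ∀ s r c, shiftSum Xc Yc (Sum.inl r) (s, c) = α * A (Fin.rev s) r c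
  bot : ∀ s p c, shiftSum Xc Yc (Sum.inr p) (s, c) = 0
  unit : IsUnit (Yc.submatrix Sum.inr (Prod.map Fin.castSucc id))

variable {α : F} {A : Fin (K + 1 + 1) → Matrix (Fin m) (Fin n) F}
  {Xc Yc : Matrix (Fin m ⊕ Fin K × Fin n) (Fin (K + 1) × Fin n) F}

lemma IsTrim.mul_hornerMat_bot (h : IsTrim α A Xc Yc) (p : Fin K × Fin n) (q : Fin (K + 1))
    (c : Fin n) : (pencil Xc Yc * hornerMat F K n) (Sum.inr p) (q, c) = C (Yc (Sum.inr p) (q, c)) := by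
  rw [pencil_mul_hornerMat]
  simp [h.bot]

lemma IsTrim.mul_hornerMat_top (h : IsTrim α A Xc Yc) (r : Fin m) (c : Fin n) :
    (pencil Xc Yc * hornerMat F K n) (Sum.inl r) (Fin.last K, c) = C α * matPoly A r c := by
  rw [pencil_mul_hornerMat, ← shiftSum_last Xc Yc (Sum.inl r) c, h.top, matPoly, Matrix.of_apply, Finset.mul_sum,
    ← Equiv.sum_comp Fin.revPerm fun i => C α * (C (A i r c) * X ^ (i : ℕ)),
    Fin.sum_univ_castSucc, Fin.sum_univ_castSucc (n := K + 1)]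
  have hlt : ¬ ((Fin.last (K + 1) : Fin (K + 2)) : ℕ) ≤ Fin.last K := by simp
  rw [if_neg hlt, add_zero, add_comm]
  refine congrArg₂ (· + ·) (Finset.sum_congr rfl fun s _ => ?_) ?_
  · have hle : (s.castSucc : ℕ) ≤ Fin.last K := Nat.lt_succ_iff.1 s.2
    have hval : (Fin.rev s.castSucc : ℕ) = (Fin.last K : ℕ) - (s.castSucc : ℕ) + 1 := by
      rw [Fin.val_rev, Fin.val_last, Fin.val_castSucc]; omega
    rw [if_pos hle, h.top, Fin.revPerm_apply, hval, C_mul, pow_succ]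
    ring
  · simp

lemma IsTrim.exists_equiv (h : IsTrim α A Xc Yc) (hα : α ≠ 0) :
    ∃ (B : Matrix (Fin m) (Fin K × Fin n) F[X]) (Q : Matrix (Fin K × Fin n) (Fin K × Fin n) F[X]),
      IsUnit (fromBlocks (C α⁻¹ • (1 : Matrix (Fin m) (Fin m) F[X])) B 0 Q).det ∧
      fromBlocks (C α⁻¹ • (1 : Matrix (Fin m) (Fin m) F[X])) B 0 Q * pencil Xc Yc *
        (hornerMat F K n).submatrix id (lastBlockEquiv K n) = fromBlocks (matPoly A) 0 0 1 := by
  set R := Yc.submatrix Sum.inr (Prod.map Fin.castSucc id)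
  set M := (pencil Xc Yc * hornerMat F K n).submatrix id (lastBlockEquiv K n) with hM
  have hblocks : M = fromBlocks (C α • matPoly A) M.toBlocks₁₂ 0 (R.map C) := by
    rw [← fromBlocks_toBlocks M, fromBlocks_inj]
    refine ⟨?_, rfl, ?_, ?_⟩
    · ext1 r c
      exact h.mul_hornerMat_top r c
    · ext1 p c
      refine (h.mul_hornerMat_bot p (Fin.last K) c).trans ?_
      rw [← shiftSum_last Xc Yc (Sum.inr p) c, h.bot]
      simp
    · ext1 p q
      exact h.mul_hornerMat_bot p q.1.castSucc q.2
  have hR : R⁻¹.map C * R.map C = (1 : Matrix _ _ F[X]) := by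
    rw [← Matrix.map_mul, Matrix.nonsing_inv_mul _ ((Matrix.isUnit_iff_isUnit_det _).1 h.unit)]
    simp
  refine ⟨-(C α⁻¹ • (M.toBlocks₁₂ * R⁻¹.map C)), R⁻¹.map C, ?_, ?_⟩
  · rw [det_fromBlocks_zero₂₁, det_smul, det_one, mul_one]
    refine IsUnit.mul ((Polynomial.isUnit_C.2 (inv_ne_zero hα).isUnit).pow _) ?_
    exact IsUnit.of_mul_eq_one _ (by rw [← det_mul, hR, det_one])
  · have hsub : pencil Xc Yc * (hornerMat F K n).submatrix id (lastBlockEquiv K n) = M := rfl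
    have hCα : C α⁻¹ * C α = (1 : F[X]) := by rw [← C_mul, inv_mul_cancel₀ hα, C_1]
    rw [Matrix.mul_assoc, hsub, hblocks, fromBlocks_multiply]
    simp only [toBlocks_fromBlocks₁₂, Matrix.neg_mul, Matrix.smul_mul, Matrix.one_mul,
      Matrix.mul_assoc, hR, Matrix.mul_one, Matrix.mul_zero, Matrix.zero_mul, add_zero, zero_add,
      smul_smul, hCα, one_smul, add_neg_cancel]

lemma pencil_mul {ρ γ γ' : Type*} [Fintype γ] (Xc Yc : Matrix ρ γ F) (W : Matrix γ γ' F) :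
    pencil (Xc * W) (Yc * W) = pencil Xc Yc * W.map C := by
  ext1 i j
  simp only [pencil, Matrix.of_apply, Matrix.mul_apply, map_sum, C_mul, Matrix.map_apply,
    Finset.sum_mul, ← Finset.sum_add_distrib]
  exact Finset.sum_congr rfl fun _ _ => by ring

lemma isLin_of_equiv {P : Matrix (Fin m) (Fin n) F[X]}
    {L : Matrix (Fin m ⊕ Fin K × Fin n) (Fin (K + 1) × Fin n) F[X]}
    (E : Matrix (Fin m ⊕ Fin K × Fin n) (Fin m ⊕ Fin K × Fin n) F[X])
    (G : Matrix (Fin (K + 1) × Fin n) (Fin (K + 1) × Fin n) F[X]) (hE : IsUnit E.det)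
    (hG : IsUnit G.det)
    (h : E * L * G.submatrix id (lastBlockEquiv K n) = fromBlocks P 0 0 1) :
    IsLin (K * n) P L := by
  let f (a : ℕ) : Fin a ⊕ Fin K × Fin n ≃ Fin a ⊕ Fin (K * n) :=
    (Equiv.refl _).sumCongr finProdFinEquiv
  let ec := (lastBlockEquiv K n).symm.trans (f n)
  refine ⟨f m, ec, E.submatrix (f m).symm (f m).symm, G.submatrix ec.symm ec.symm, ?_, ?_, ?_⟩
  · rwa [det_submatrix_equiv_self]
  · rwa [det_submatrix_equiv_self]
  · have h2 : G.submatrix ec.symm ec.symm =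
        (G.submatrix id (lastBlockEquiv K n)).submatrix ec.symm (f n).symm := rfl
    rw [reindex_apply, h2, submatrix_mul_equiv, submatrix_mul_equiv, h]
    ext1 i j
    obtain ⟨i, rfl⟩ := (f m).surjective i
    obtain ⟨j, rfl⟩ := (f n).surjective j
    rw [submatrix_apply, Equiv.symm_apply_apply, Equiv.symm_apply_apply]
    rcases i with i | i <;> rcases j with j | j <;>
      simp [f, Matrix.one_apply, -finProdFinEquiv_apply_val]

lemma revMat_pencil {ρ γ : Type*} (Xc Yc : Matrix ρ γ F) :
    revMat 1 (pencil Xc Yc) = pencil Yc Xc := by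
  ext1 i j
  have h1 := reflect_C_mul_X_pow 1 1 (c := Xc i j)
  have h2 := reflect_C_mul_X_pow 1 0 (c := Yc i j)
  simp only [pow_one, revAt_le le_rfl, revAt_le zero_le_one, pow_zero, mul_one, tsub_self,
    tsub_zero] at h1 h2
  simp only [revMat, pencil, Matrix.map_apply, Matrix.of_apply, reflect_add, h1, h2]
  ring

lemma revMat_matPoly {k : ℕ} (A : Fin (k + 1) → Matrix (Fin m) (Fin n) F) :
    revMat k (matPoly A) = matPoly fun i => A (Fin.rev i) := by
  ext1 r c
  let φ : F[X] →+ F[X] :=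
    { toFun := reflect k, map_zero' := reflect_zero, map_add' := fun p q => reflect_add p q k }
  change φ (matPoly A r c) = _
  rw [matPoly, Matrix.of_apply, map_sum, matPoly, Matrix.of_apply, ← Equiv.sum_comp Fin.revPerm]
  refine Finset.sum_congr rfl fun i _ => ?_
  have hφ (p : F[X]) : φ p = reflect k p := rfl
  rw [hφ, reflect_C_mul_X_pow, revAt_le (Fin.is_le _), Fin.revPerm_apply, Fin.val_rev]
  congr 2
  omega

/-- Reversing a trimmed pencil and the order of its block columns gives a trimmed pencil. -/
lemma IsTrim.rev (h : IsTrim α A Xc Yc) :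
    IsTrim α (fun i => A (Fin.rev i)) (Yc.submatrix id (Prod.map Fin.rev id))
      (Xc.submatrix id (Prod.map Fin.rev id)) := by
  have hshift (i : Fin m ⊕ Fin K × Fin n) (s : Fin (K + 2)) (c : Fin n) :
      shiftSum (Yc.submatrix id (Prod.map Fin.rev id)) (Xc.submatrix id (Prod.map Fin.rev id)) i
        (s, c) = shiftSum Xc Yc i (Fin.rev s, c) := by
    induction s using forall_fin_shift with
    | h0 =>
      rw [shiftSum_zero, Fin.rev_zero, shiftSum_last]
      simp
    | hl =>
      rw [shiftSum_last, Fin.rev_last, shiftSum_zero]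
      simp
    | hm q =>
      rw [shiftSum_castSucc_succ, Fin.rev_castSucc, Fin.rev_succ, Fin.succ_castSucc,
        shiftSum_castSucc_succ]
      simp [Fin.rev_succ, Fin.rev_castSucc, add_comm]
  refine ⟨fun s r c => ?_, fun s p c => ?_, ?_⟩
  · rw [hshift, h.top]
  · rw [hshift, h.bot]
  · have hX (p : Fin K × Fin n) (q : Fin K) (c : Fin n) :
        Xc (Sum.inr p) (q.succ, c) = -Yc (Sum.inr p) (q.castSucc, c) := by
      have := h.bot q.succ.castSucc p c
      rw [shiftSum_castSucc_succ] at this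
      exact eq_neg_of_add_eq_zero_left this
    have heq : (Xc.submatrix id (Prod.map Fin.rev id)).submatrix Sum.inr
        (Prod.map Fin.castSucc id) = -(Yc.submatrix Sum.inr
          (Prod.map Fin.castSucc id)).submatrix (Equiv.refl _)
            (Fin.revPerm.prodCongr (Equiv.refl (Fin n))) := by
      ext p ⟨q, c⟩
      simp [Fin.rev_castSucc, hX]
    rw [heq]
    exact ((Matrix.isUnit_submatrix_equiv _ _).2 h.unit).neg

lemma IsTrim.isLin (hα : α ≠ 0) {W : Matrix (Fin (K + 1) × Fin n) (Fin (K + 1) × Fin n) F}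
    (hW : IsUnit W) (h : IsTrim α A (Xc * W) (Yc * W)) :
    IsLin (K * n) (matPoly A) (pencil Xc Yc) := by
  obtain ⟨B, Q, hdet, hE⟩ := h.exists_equiv hα
  refine isLin_of_equiv _ (W.map C * hornerMat F K n) hdet (isUnit_det_mul_hornerMat hW) ?_
  rw [← hE, pencil_mul]
  simp only [Matrix.mul_assoc]
  rfl

lemma IsTrim.isStrongLin (hα : α ≠ 0)
    {W : Matrix (Fin (K + 1) × Fin n) (Fin (K + 1) × Fin n) F}
    (hW : IsUnit W) (h : IsTrim α A (Xc * W) (Yc * W)) :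
    IsStrongLin (K * n) A (pencil Xc Yc) := by
  refine ⟨h.isLin hα hW, ?_⟩
  rw [revMat_pencil, revMat_matPoly]
  refine IsTrim.isLin hα (W := W.submatrix (Equiv.refl _)
    (Fin.revPerm.prodCongr (Equiv.refl (Fin n)))) ((Matrix.isUnit_submatrix_equiv _ _).2 hW) h.rev

end Horner

section MinimalIndices

variable {γ γ' ρ : Type*}

lemma polyVec_injective : Function.Injective (polyVec (F := F) (γ := γ)) := fun _ _ h =>
  funext fun i => IsFractionRing.injective F[X] (RatFunc F) (congrFun h i)

lemma polyVec_zero : polyVec (0 : γ → F[X]) = 0 := by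
  ext i
  simp [polyVec]

lemma matRF_one [DecidableEq γ] : matRF (1 : Matrix γ γ F[X]) = 1 := by
  simp [matRF]

variable [Fintype γ]

lemma matRF_mulVec_polyVec (T : Matrix ρ γ F[X]) (x : γ → F[X]) :
    matRF T *ᵥ polyVec x = polyVec (T *ᵥ x) := by
  ext i
  simp [matRF, polyVec, Matrix.mulVec, dotProduct]

lemma matRF_mul (S : Matrix ρ γ F[X]) (T : Matrix γ γ' F[X]) :
    matRF (S * T) = matRF S * matRF T := Matrix.map_mul

lemma polyVec_mem_Nr {P : Matrix ρ γ F[X]} {x : γ → F[X]} :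
    polyVec x ∈ Nr P ↔ P *ᵥ x = 0 := by
  rw [Nr, LinearMap.mem_ker, mulVecLin_apply, matRF_mulVec_polyVec, ← polyVec_zero,
    polyVec_injective.eq_iff]

lemma IsPolyBasis.finrank_eq {V : Submodule (RatFunc F) (γ → RatFunc F)} {d : ℕ}
    {b : Fin d → γ → F[X]} (h : IsPolyBasis V b) : Module.finrank (RatFunc F) V = d := by
  rw [← h.2, finrank_span_eq_card h.1, Fintype.card_fin]

lemma IsPolyBasis.ne_zero {V : Submodule (RatFunc F) (γ → RatFunc F)} {d : ℕ}
    {b : Fin d → γ → F[X]} (h : IsPolyBasis V b) (i : Fin d) : b i ≠ 0 := fun h0 =>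
  h.1.ne_zero i (by simp only [h0, polyVec_zero])

lemma IsPolyBasis.mem {V : Submodule (RatFunc F) (γ → RatFunc F)} {d : ℕ}
    {b : Fin d → γ → F[X]} (h : IsPolyBasis V b) (i : Fin d) : polyVec (b i) ∈ V :=
  h.2 ▸ Submodule.subset_span ⟨i, rfl⟩

section Transfer

variable [Fintype γ'] [DecidableEq γ] {V : Submodule (RatFunc F) (γ → RatFunc F)} {T : Matrix γ' γ F[X]}
  {S : Matrix γ γ' F[X]}

lemma isPolyBasis_map_iff (hS : S * T = 1) {d : ℕ} {b : Fin d → γ → F[X]} :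
    IsPolyBasis (V.map (matRF T).mulVecLin) (fun i => T *ᵥ b i) ↔ IsPolyBasis V b := by
  have hST : matRF S * matRF T = 1 := by rw [← matRF_mul, hS, matRF_one]
  have hinj : Function.Injective (matRF T).mulVecLin := fun x y hxy => by
    have := congrArg (matRF S *ᵥ ·) hxy
    simpa [Matrix.mulVec_mulVec, hST] using this
  have hcomp : (fun i => polyVec (T *ᵥ b i)) = (matRF T).mulVecLin ∘ fun i => polyVec (b i) := by
    ext1 i
    rw [← matRF_mulVec_polyVec]
    rfl
  rw [IsPolyBasis, IsPolyBasis, hcomp, Set.range_comp, ← Submodule.map_span,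
    (Submodule.map_injective_of_injective hinj).eq_iff,
    LinearMap.linearIndependent_iff _ (LinearMap.ker_eq_bot.2 hinj)]

lemma mulVec_mulVec_of_mem_map (hS : S * T = 1) {y : γ' → F[X]}
    (hy : polyVec y ∈ V.map (matRF T).mulVecLin) : T *ᵥ (S *ᵥ y) = y := by
  have hST : matRF S * matRF T = 1 := by rw [← matRF_mul, hS, matRF_one]
  obtain ⟨x, -, hx⟩ := hy
  rw [mulVecLin_apply] at hx
  apply polyVec_injective
  rw [← matRF_mulVec_polyVec, ← matRF_mulVec_polyVec, ← hx, Matrix.mulVec_mulVec x (matRF S), hST,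
    Matrix.one_mulVec]

/-- A left invertible polynomial matrix that shifts degrees by `s` on a subspace shifts the minimal
indices of that subspace by `s`. -/
lemma hasMinIndices_map_iff (hS : S * T = 1) {s : ℕ}
    (hdeg : ∀ x : γ → F[X], x ≠ 0 → polyVec x ∈ V → polyVecDeg (T *ᵥ x) = polyVecDeg x + s)
    {d : ℕ} (ε : Fin d → ℕ) :
    HasMinIndices V ε ↔ HasMinIndices (V.map (matRF T).mulVecLin) fun i => ε i + s := by
  have hsum {e : ℕ} {b : Fin e → γ → F[X]} (hb : IsPolyBasis V b) :
      ∑ i, polyVecDeg (T *ᵥ b i) =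
        ∑ i, polyVecDeg (b i) + Module.finrank (RatFunc F) V * s := by
    rw [Finset.sum_congr rfl fun i _ => hdeg _ (hb.ne_zero i) (hb.mem i), Finset.sum_add_distrib,
      hb.finrank_eq]
    simp
  have hback {e : ℕ} {b : Fin e → γ' → F[X]} (hb : IsPolyBasis (V.map (matRF T).mulVecLin) b) :
      (fun i => T *ᵥ (S *ᵥ b i)) = b :=
    funext fun i => mulVec_mulVec_of_mem_map hS (hb.mem i)
  have hback' {e : ℕ} {b : Fin e → γ' → F[X]} (hb : IsPolyBasis (V.map (matRF T).mulVecLin) b) :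
      IsPolyBasis V fun i => S *ᵥ b i := by
    rw [← isPolyBasis_map_iff hS, hback hb]
    exact hb
  have hmin {e : ℕ} {b : Fin e → γ → F[X]} :
      IsMinimalBasis (V.map (matRF T).mulVecLin) (fun i => T *ᵥ b i) ↔ IsMinimalBasis V b := by
    rw [IsMinimalBasis, IsMinimalBasis, isPolyBasis_map_iff hS]
    refine and_congr_right fun hb => ⟨fun h d' b' hb' => ?_, fun h d' b' hb' => ?_⟩
    · have := h d' _ ((isPolyBasis_map_iff hS).2 hb')
      rw [hsum hb, hsum hb'] at this
      omega
    · have := h d' _ (hback' hb')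
      rw [hsum hb, ← hback hb', hsum (hback' hb')]
      omega
  constructor
  · rintro ⟨b, hb, hε⟩
    exact ⟨_, hmin.2 hb, fun i => by rw [hdeg _ (hb.1.ne_zero i) (hb.1.mem i), hε]⟩
  · rintro ⟨b, hb, hε⟩
    have hb' := hback' hb.1
    refine ⟨fun i => S *ᵥ b i, hmin.1 ((hback hb.1).symm ▸ hb), fun i => ?_⟩
    have h1 := hdeg _ (hb'.ne_zero i) (hb'.mem i)
    rw [congrFun (hback hb.1) i, hε] at h1
    exact (Nat.add_right_cancel h1).symm

end Transfer

section Equivalence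

variable [Fintype ρ] {ι ι' κ : Type*} [Fintype ι] [Fintype κ] [DecidableEq κ]
  {P : Matrix ι ι' F[X]} {L : Matrix ρ γ F[X]}
  {E : Matrix (ι ⊕ κ) ρ F[X]} {E' : Matrix ρ (ι ⊕ κ) F[X]}
  {G : Matrix γ (ι' ⊕ κ) F[X]} {G' : Matrix (ι' ⊕ κ) γ F[X]}

lemma mul_submatrix_inl_of_equiv [DecidableEq ρ] (h : E * L * G = fromBlocks P 0 0 1)
    (hE : E' * E = 1) :
    L * G.submatrix id Sum.inl = E' * fromRows P (0 : Matrix κ ι' F[X]) := by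
  have hinl : fromRows P (0 : Matrix κ ι' F[X]) =
      (fromBlocks P 0 0 (1 : Matrix κ κ F[X])).submatrix id Sum.inl := by
    ext (i | i) j <;> simp
  rw [hinl, ← h, Matrix.mul_assoc E L, submatrix_mul _ _ id id Sum.inl Function.bijective_id,
    submatrix_mul _ _ id id Sum.inl Function.bijective_id, submatrix_id_id, submatrix_id_id,
    ← Matrix.mul_assoc E' E, hE, Matrix.one_mul]

variable [Fintype ι']

lemma Nr_eq_map_of_equiv [DecidableEq ρ] [DecidableEq γ] (h : E * L * G = fromBlocks P 0 0 1)
    (hE : E' * E = 1) (hG : G * G' = 1) :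
    Nr L = (Nr P).map (matRF (G.submatrix id Sum.inl)).mulVecLin := by
  ext y
  constructor
  · intro hy
    rw [Nr, LinearMap.mem_ker, mulVecLin_apply] at hy
    set z := matRF G' *ᵥ y with hz
    have hGz : matRF G *ᵥ z = y := by
      rw [hz, Matrix.mulVec_mulVec, ← matRF_mul, hG, matRF_one, Matrix.one_mulVec]
    have hD : matRF (fromBlocks P 0 0 (1 : Matrix κ κ F[X])) *ᵥ z = 0 := by
      rw [← h, matRF_mul, ← Matrix.mulVec_mulVec, hGz, matRF_mul, ← Matrix.mulVec_mulVec, hy,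
        Matrix.mulVec_zero]
    have hblocks : matRF (fromBlocks P 0 0 (1 : Matrix κ κ F[X])) =
        fromBlocks (matRF P) 0 0 1 := by
      rw [← matRF_one, matRF, fromBlocks_map]
      congr 1 <;> ext <;> simp
    rw [hblocks, fromBlocks_mulVec] at hD
    have hr : z ∘ Sum.inr = 0 := by
      ext1 i
      simpa using congrFun hD (Sum.inr i)
    refine ⟨z ∘ Sum.inl, ?_, ?_⟩
    · rw [SetLike.mem_coe, Nr, LinearMap.mem_ker, mulVecLin_apply]
      ext1 i
      simpa using congrFun hD (Sum.inl i)
    · rw [← hGz, mulVecLin_apply]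
      ext1 i
      have hr' (j : κ) : z (Sum.inr j) = 0 := congrFun hr j
      simp [Matrix.mulVec, dotProduct, hr', matRF]
  · rintro ⟨x, hx, rfl⟩
    rw [SetLike.mem_coe, Nr, LinearMap.mem_ker, mulVecLin_apply] at hx
    rw [Nr, LinearMap.mem_ker, mulVecLin_apply, mulVecLin_apply, Matrix.mulVec_mulVec, ← matRF_mul,
      mul_submatrix_inl_of_equiv h hE, matRF_mul, ← Matrix.mulVec_mulVec]
    have : matRF (fromRows P (0 : Matrix κ ι' F[X])) *ᵥ x = 0 := by
      ext1 (i | i)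
      · exact congrFun hx i
      · simp [matRF, Matrix.mulVec, dotProduct]
    rw [this, Matrix.mulVec_zero]

lemma hasMinIndices_Nr_iff_of_equiv [DecidableEq ρ] [DecidableEq γ] [DecidableEq ι']
    (h : E * L * G = fromBlocks P 0 0 1) (hE : E' * E = 1) (hG : G * G' = 1) (hG' : G' * G = 1)
    {s : ℕ} (hdeg : ∀ x : ι' → F[X], x ≠ 0 → P *ᵥ x = 0 →
      polyVecDeg (G.submatrix id Sum.inl *ᵥ x) = polyVecDeg x + s)
    {d : ℕ} (ε : Fin d → ℕ) :
    HasMinIndices (Nr P) ε ↔ HasMinIndices (Nr L) fun i => ε i + s := by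
  rw [Nr_eq_map_of_equiv h hE hG]
  refine hasMinIndices_map_iff (S := G'.submatrix Sum.inl id) ?_
    (fun x hx hxP => hdeg x hx (polyVec_mem_Nr.1 hxP)) ε
  rw [← submatrix_mul _ _ _ _ _ Function.bijective_id, hG']
  ext i j
  simp [Matrix.one_apply]

end Equivalence

lemma natDegree_le_polyVecDeg (x : γ → F[X]) (i : γ) : (x i).natDegree ≤ polyVecDeg x :=
  Finset.le_sup (f := fun i => (x i).natDegree) (Finset.mem_univ i)

lemma polyVecDeg_le {x : γ → F[X]} {N : ℕ} (h : ∀ i, (x i).natDegree ≤ N) : polyVecDeg x ≤ N :=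
  Finset.sup_le fun i _ => h i

lemma exists_coeff_polyVecDeg_ne_zero {x : γ → F[X]} (hx : x ≠ 0) :
    ∃ i, (x i).coeff (polyVecDeg x) ≠ 0 := by
  by_contra! h
  obtain ⟨i, hi⟩ := Function.ne_iff.1 hx
  obtain ⟨j, -, hj⟩ := Finset.exists_mem_eq_sup (Finset.univ : Finset γ) ⟨i, Finset.mem_univ i⟩
    fun i => (x i).natDegree
  have hj0 : (x j).leadingCoeff = 0 := by
    rw [leadingCoeff, ← hj]
    exact h j
  have hdeg : polyVecDeg x = 0 := by
    rw [polyVecDeg, hj, leadingCoeff_eq_zero.1 hj0, natDegree_zero]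
  have hi0 := h i
  have hle := natDegree_le_polyVecDeg x i
  rw [hdeg] at hi0 hle
  refine hi ?_
  rw [eq_C_of_natDegree_le_zero hle, hi0, C_0]
  rfl

lemma polyVecDeg_map_C_mulVec_le [Fintype ρ] (W : Matrix ρ γ F) (x : γ → F[X]) :
    polyVecDeg (W.map C *ᵥ x) ≤ polyVecDeg x := by
  refine polyVecDeg_le fun i => natDegree_sum_le_of_forall_le _ _ fun j _ => ?_
  exact (natDegree_C_mul_le _ _).trans (natDegree_le_polyVecDeg x j)

lemma polyVecDeg_map_C_mulVec [DecidableEq γ] {W : Matrix γ γ F} (hW : IsUnit W) (x : γ → F[X]) :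
    polyVecDeg (W.map C *ᵥ x) = polyVecDeg x := by
  refine (polyVecDeg_map_C_mulVec_le W x).antisymm ?_
  have h := polyVecDeg_map_C_mulVec_le W⁻¹ (W.map C *ᵥ x)
  rw [Matrix.mulVec_mulVec, ← Matrix.map_mul,
    Matrix.nonsing_inv_mul _ ((Matrix.isUnit_iff_isUnit_det _).1 hW)] at h
  simpa using h

end MinimalIndices

section TrimIndices

variable {K m n : ℕ} {α : F} {A : Fin (K + 1 + 1) → Matrix (Fin m) (Fin n) F}
  {Xc Yc : Matrix (Fin m ⊕ Fin K × Fin n) (Fin (K + 1) × Fin n) F}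

lemma polyVecDeg_hornerMat_inl {x : Fin n → F[X]} (hx : x ≠ 0) :
    polyVecDeg (((hornerMat F K n).submatrix id (lastBlockEquiv K n)).submatrix id Sum.inl *ᵥ x) =
      polyVecDeg x + K := by
  have happ (p : Fin (K + 1)) (c : Fin n) :
      (((hornerMat F K n).submatrix id (lastBlockEquiv K n)).submatrix id Sum.inl *ᵥ x) (p, c) =
        x c * X ^ (K - p) := by
    have hp : p ≤ Fin.last K := Fin.le_last p
    simp [Matrix.mulVec, dotProduct, hornerMat, lastBlockEquiv, hp, Matrix.one_apply, mul_comm]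
  refine le_antisymm (polyVecDeg_le ?_) ?_
  · rintro ⟨p, c⟩
    rw [happ]
    have h1 := natDegree_le_polyVecDeg x c
    have h2 := natDegree_mul_le (p := x c) (q := X ^ (K - (p : ℕ)))
    rw [natDegree_X_pow] at h2
    omega
  · obtain ⟨c, hc⟩ := exists_coeff_polyVecDeg_ne_zero hx
    refine le_trans ?_ (natDegree_le_polyVecDeg _ ((0 : Fin (K + 1)), c))
    rw [happ]
    refine le_natDegree_of_ne_zero ?_
    simpa using hc

/-- In a left null vector of a trimmed pencil the top block has maximal degree. -/
lemma IsTrim.polyVecDeg_eq (h : IsTrim α A Xc Yc) {y : Fin m ⊕ Fin K × Fin n → F[X]}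
    (hy : (pencil Xc Yc)ᵀ *ᵥ y = 0) : polyVecDeg y = polyVecDeg (y ∘ Sum.inl) := by
  set N := polyVecDeg y with hN
  refine le_antisymm ?_ (polyVecDeg_le fun i => natDegree_le_polyVecDeg y (Sum.inl i))
  by_contra! hlt
  have hy0 : y ≠ 0 := by
    rintro rfl
    simp [hN, polyVecDeg] at hlt
  set v : Fin K × Fin n → F := fun p => (y (Sum.inr p)).coeff N with hv
  set R := Yc.submatrix Sum.inr (Prod.map Fin.castSucc id) with hR
  have hvR : v ᵥ* R = 0 := by
    ext1 ⟨q, c⟩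
    have hcol := congrArg (fun p => coeff p (N + 1)) (congrFun hy (q.succ, c))
    have hterm (i : Fin m ⊕ Fin K × Fin n) :
        ((C (Xc i (q.succ, c)) * X + C (Yc i (q.succ, c))) * y i).coeff (N + 1) =
          Xc i (q.succ, c) * (y i).coeff N := by
      have h0 : (y i).coeff (N + 1) = 0 :=
        coeff_eq_zero_of_natDegree_lt (Nat.lt_succ_of_le (natDegree_le_polyVecDeg y i))
      rw [add_mul, coeff_add, coeff_C_mul, h0, mul_assoc, coeff_C_mul, coeff_X_mul]
      ring
    have htop (i : Fin m) : (y (Sum.inl i)).coeff N = 0 :=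
      coeff_eq_zero_of_natDegree_lt
        ((natDegree_le_polyVecDeg (y ∘ Sum.inl) i).trans_lt hlt)
    have hX (p : Fin K × Fin n) :
        Xc (Sum.inr p) (q.succ, c) = -Yc (Sum.inr p) (q.castSucc, c) := by
      have := h.bot q.succ.castSucc p c
      rw [shiftSum_castSucc_succ] at this
      exact eq_neg_of_add_eq_zero_left this
    have hsum : ∑ i, Xc i (q.succ, c) * (y i).coeff N = 0 := by
      rw [← Finset.sum_congr rfl fun i _ => hterm i, ← finsetSum_coeff]
      exact hcol
    simp only [Fintype.sum_sum_type, htop, mul_zero, Finset.sum_const_zero, zero_add, hX, neg_mul,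
      Finset.sum_neg_distrib, neg_eq_zero] at hsum
    refine Eq.trans ?_ hsum
    exact Finset.sum_congr rfl fun p _ => mul_comm (v p) (R p (q, c))
  have hv0 : v = 0 := by
    have := congrArg (· ᵥ* R⁻¹) hvR
    simp only [Matrix.vecMul_vecMul, Matrix.zero_vecMul] at this
    rwa [Matrix.mul_nonsing_inv _ ((Matrix.isUnit_iff_isUnit_det _).1 h.unit),
      Matrix.vecMul_one] at this
  obtain ⟨i | p, hi⟩ := exists_coeff_polyVecDeg_ne_zero hy0
  · exact hi (coeff_eq_zero_of_natDegree_lt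
      ((natDegree_le_polyVecDeg (y ∘ Sum.inl) i).trans_lt hlt))
  · exact hi (congrFun hv0 p)

/-- The right minimal indices of a trimmed pencil are those of the matrix polynomial shifted by
`K`, the left ones are the same. -/
lemma IsTrim.hasMinIndices_iff (hα : α ≠ 0)
    {W : Matrix (Fin (K + 1) × Fin n) (Fin (K + 1) × Fin n) F}
    (hW : IsUnit W) (h : IsTrim α A (Xc * W) (Yc * W)) {d : ℕ} (ε : Fin d → ℕ) :
    (HasMinIndices (Nr (matPoly A)) ε ↔
      HasMinIndices (Nr (pencil Xc Yc)) fun i => ε i + K) ∧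
    (HasMinIndices (Nl (matPoly A)) ε ↔ HasMinIndices (Nl (pencil Xc Yc)) ε) := by
  obtain ⟨B, Q, hdet, hE⟩ := h.exists_equiv hα
  set E := fromBlocks (C α⁻¹ • (1 : Matrix (Fin m) (Fin m) F[X])) B 0 Q with hEdef
  set V := W.map C * hornerMat F K n with hV
  have hVdet : IsUnit V.det := isUnit_det_mul_hornerMat hW
  set G := V.submatrix id (lastBlockEquiv K n) with hG
  set G' := V⁻¹.submatrix (lastBlockEquiv K n) id with hG'
  have hGG' : G * G' = 1 := by
    rw [hG, hG', submatrix_mul_equiv, Matrix.mul_nonsing_inv _ hVdet, submatrix_id_id]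
  have hG'G : G' * G = 1 := by
    rw [hG, hG', ← submatrix_mul _ _ _ _ _ Function.bijective_id, Matrix.nonsing_inv_mul _ hVdet,
      submatrix_one_equiv]
  have hEE' : E * E⁻¹ = 1 := Matrix.mul_nonsing_inv _ hdet
  have hE'E : E⁻¹ * E = 1 := Matrix.nonsing_inv_mul _ hdet
  have hEG : E * pencil Xc Yc * G = fromBlocks (matPoly A) 0 0 1 := by
    rw [← hE, pencil_mul]
    simp only [Matrix.mul_assoc]
    rfl
  constructor
  · refine hasMinIndices_Nr_iff_of_equiv hEG hE'E hGG' hG'G (fun x hx _ => ?_) ε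
    have : G.submatrix id Sum.inl = W.map C *
        ((hornerMat F K n).submatrix id (lastBlockEquiv K n)).submatrix id Sum.inl := rfl
    rw [this, ← Matrix.mulVec_mulVec, polyVecDeg_map_C_mulVec hW, polyVecDeg_hornerMat_inl hx]
  · have hEGT : Gᵀ * (pencil Xc Yc)ᵀ * Eᵀ = fromBlocks (matPoly A)ᵀ 0 0 1 := by
      rw [Matrix.mul_assoc, ← Matrix.transpose_mul, ← Matrix.transpose_mul, hEG,
        fromBlocks_transpose]
      simp
    have hGT : G'ᵀ * Gᵀ = 1 := by rw [← Matrix.transpose_mul, hGG', Matrix.transpose_one]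
    refine hasMinIndices_Nr_iff_of_equiv (s := 0) hEGT hGT (G' := E⁻¹ᵀ)
      (by rw [← Matrix.transpose_mul, hE'E, Matrix.transpose_one])
      (by rw [← Matrix.transpose_mul, hEE', Matrix.transpose_one]) (fun x _ hx => ?_) ε
    set y := Eᵀ.submatrix id Sum.inl *ᵥ x with hy
    have hLy : (pencil Xc Yc)ᵀ *ᵥ y = 0 := by
      rw [hy, Matrix.mulVec_mulVec, mul_submatrix_inl_of_equiv hEGT hGT, ← Matrix.mulVec_mulVec,
        fromRows_mulVec, hx]
      have : Sum.elim (0 : Fin n → F[X]) ((0 : Matrix (Fin K × Fin n) (Fin m) F[X]) *ᵥ x) = 0 := by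
        ext1 (i | i) <;> simp
      rw [this, Matrix.mulVec_zero]
    have hMy : (pencil (Xc * W) (Yc * W))ᵀ *ᵥ y = 0 := by
      rw [pencil_mul, Matrix.transpose_mul, ← Matrix.mulVec_mulVec, hLy, Matrix.mulVec_zero]
    have hytop (i : Fin m) : y (Sum.inl i) = C α⁻¹ * x i := by
      simp [hy, hEdef, Matrix.mulVec, dotProduct, Matrix.one_apply]
    rw [h.polyVecDeg_eq hMy, add_zero, polyVecDeg, polyVecDeg]
    refine Finset.sup_congr rfl fun i _ => ?_
    rw [Function.comp_apply, hytop, natDegree_C_mul (inv_ne_zero hα)]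

end TrimIndices

section BackwardError

open scoped Matrix.Norms.Frobenius

variable {K m n : ℕ} {α : F} {A : Fin (K + 1 + 1) → Matrix (Fin m) (Fin n) F}
  {X12 Y11 : Matrix (Fin m) (Fin K × Fin n) F} {R : Matrix (Fin K × Fin n) (Fin K × Fin n) F}

lemma LtX_submatrix_inr {Ak : Matrix (Fin m) (Fin n) F} :
    (LtX (k := K + 1) α Ak X12 R).submatrix Sum.inr id = R * shiftX F K n := by
  refine Matrix.ext fun (p : Fin K × Fin n) (q, c) => ?_
  induction q using Fin.cases with
  | zero => simp [LtX, shiftX, Matrix.mul_apply, Prod.map]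
  | succ q =>
    simp [LtX, shiftX, Matrix.mul_apply, Matrix.one_apply, Fintype.sum_prod_type, ite_and]

lemma LtY_submatrix_inr {Az : Matrix (Fin m) (Fin n) F} :
    (LtY (k := K + 1) α Az Y11 R).submatrix Sum.inr id = R * shiftY F K n := by
  refine Matrix.ext fun (p : Fin K × Fin n) (q, c) => ?_
  induction q using Fin.lastCases with
  | last => simp [LtY, shiftY, Matrix.mul_apply, Prod.map, Fin.castSucc_ne_last]
  | cast q =>
    simp [LtY, shiftY, Matrix.mul_apply, Matrix.one_apply, Fintype.sum_prod_type, ite_and]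

lemma isTrim_Lt (hXY : ∀ (i : Fin m) (p : Fin K × Fin n),
      X12 i p + Y11 i p = α * A ⟨K - (p.1 : ℕ), by omega⟩ i p.2) (hR : IsUnit R) :
    IsTrim α A (LtX (k := K + 1) α (A (Fin.last (K + 1))) X12 R)
      (LtY (k := K + 1) α (A 0) Y11 R) where
  top s r c := by
    induction s using forall_fin_shift with
    | h0 => simp [shiftSum_zero, LtX]
    | hl => simp [shiftSum_last, LtY]
    | hm q =>
      have hq : Fin.rev q.succ.castSucc = (⟨K - (q : ℕ), by omega⟩ : Fin (K + 1 + 1)) := by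
        ext
        simp only [Fin.val_rev, Fin.val_castSucc, Fin.val_succ]
        omega
      rw [shiftSum_castSucc_succ, hq, ← hXY r (q, c)]
      simp [LtX, LtY]
  bot s p c := by
    induction s using forall_fin_shift with
    | h0 => simp [shiftSum_zero, LtX]
    | hl => simp [shiftSum_last, LtY]
    | hm q =>
      rw [shiftSum_castSucc_succ]
      simp [LtX, LtY]
  unit := by
    convert hR using 1
    ext p ⟨q, c⟩
    simp [LtY]

lemma famFrob_eq_of_rev (a : F) (g : Matrix (Fin m) (Fin (K + 1 + 1) × Fin n) F) :
    famFrob (fun i : Fin (K + 1 + 1) => Matrix.of fun r c => a * g r (Fin.rev i, c)) =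
      ‖a‖ * ‖g‖ := by
  rw [famFrob, ← Real.sqrt_sq (mul_nonneg (norm_nonneg a) (norm_nonneg g)), mul_pow,
    ← frobSq_eq_norm_sq]
  congr 1
  simp only [frobSq, Matrix.of_apply, norm_mul, mul_pow, ← Finset.mul_sum, Fintype.sum_prod_type]
  congr 1
  rw [Finset.sum_comm]
  exact Finset.sum_congr rfl fun r _ =>
    Equiv.sum_comp Fin.revPerm fun i => ∑ c, ‖g r (i, c)‖ ^ 2

lemma sigmaMin_pos_of_lt {ρ γ : Type*} [Fintype ρ] [Fintype γ] {M N : Matrix ρ γ F}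
    (h : penFrob M N < sigmaMin R / (2 * (((K : ℝ) + 1) * Real.sqrt (K + 1)))) :
    0 < sigmaMin R := by
  have := (penFrob_nonneg M N).trans_lt h
  rwa [div_pos_iff_of_pos_right (by positivity)] at this

lemma IsTrim.mul_one {Xc Yc : Matrix (Fin m ⊕ Fin K × Fin n) (Fin (K + 1) × Fin n) F}
    (h : IsTrim α A Xc Yc) :
    IsTrim α A (Xc * (1 : Matrix (Fin (K + 1) × Fin n) (Fin (K + 1) × Fin n) F))
      (Yc * (1 : Matrix (Fin (K + 1) × Fin n) (Fin (K + 1) × Fin n) F)) := by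
  rwa [Matrix.mul_one, Matrix.mul_one]

lemma IsTrim.penFrob_ne_zero {Xc Yc : Matrix (Fin m ⊕ Fin K × Fin n) (Fin (K + 1) × Fin n) F}
    (h : IsTrim α A Xc Yc) (hne : Nonempty (Fin K × Fin n)) : penFrob Xc Yc ≠ 0 := by
  intro h0
  have hY : Yc = 0 := norm_le_zero_iff.1 (h0 ▸ norm_right_le_penFrob Xc Yc)
  have hunit := h.unit
  rw [hY, submatrix_zero] at hunit
  exact not_isUnit_zero hunit

/-- A pencil close to a trimmed pencil becomes a trimmed pencil after right multiplication by a
constant invertible matrix. -/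
lemma IsTrim.exists_perturbation {Xh Yh : Matrix (Fin m ⊕ Fin K × Fin n) (Fin (K + 1) × Fin n) F}
    (hα : α ≠ 0) (h : IsTrim α A Xh Yh) (hR : IsUnit R)
    (hX : Xh.submatrix Sum.inr id = R * shiftX F K n)
    (hY : Yh.submatrix Sum.inr id = R * shiftY F K n)
    (DX DY : Matrix (Fin m ⊕ Fin K × Fin n) (Fin (K + 1) × Fin n) F)
    (hD : penFrob DX DY < sigmaMin R / (2 * (((K : ℝ) + 1) * Real.sqrt (K + 1)))) :
    ∃ (DA : Fin (K + 1 + 1) → Matrix (Fin m) (Fin n) F)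
      (W : Matrix (Fin (K + 1) × Fin n) (Fin (K + 1) × Fin n) F),
      IsUnit W ∧ IsTrim α (fun i => A i + DA i) ((Xh + DX) * W) ((Yh + DY) * W) ∧
      famFrob DA ≤ 1 / ‖α‖ * (3 + 2 * ((K : ℝ) + 1) *
        penFrob (Xh.submatrix Sum.inl id) (Yh.submatrix Sum.inl id) / sigmaMin R) *
          penFrob DX DY := by
  have hσ : 0 < sigmaMin R := sigmaMin_pos_of_lt hD
  have hK : 0 < K := by
    obtain ⟨p, -⟩ := nonempty_of_sigmaMin_pos R hσ
    exact p.pos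
  have hinr := penFrob_submatrix_le DX DY (Sum.inr_injective (α := Fin m) (β := Fin K × Fin n))
  have hinl := penFrob_submatrix_le DX DY (Sum.inl_injective (α := Fin m) (β := Fin K × Fin n))
  obtain ⟨D, hD0, hDn, hDh, hDu⟩ := exists_restoring hK R hR (DX.submatrix Sum.inr id)
    (DY.submatrix Sum.inr id) hσ (hinr.trans_lt hD)
  rw [← hX, ← hY] at hD0
  rw [← hY] at hDu
  set Xt := Xh.submatrix Sum.inl id with hXt
  set Yt := Yh.submatrix Sum.inl id with hYt
  set DXt := DX.submatrix Sum.inl id with hDXt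
  set DYt := DY.submatrix Sum.inl id with hDYt
  set g := shiftSum (Xt * D + (DXt + DXt * D)) (Yt * D + (DYt + DYt * D)) with hg
  have hsplit (M N : Matrix (Fin m) (Fin (K + 1) × Fin n) F) :
      (M + N) * (1 + D) = M + (M * D + (N + N * D)) := by
    simp only [Matrix.add_mul, Matrix.mul_add, Matrix.mul_one]
    abel
  have htop : shiftSum ((Xt + DXt) * (1 + D)) ((Yt + DYt) * (1 + D)) = shiftSum Xt Yt + g := by
    rw [hsplit, hsplit, shiftSum_add]
  refine ⟨fun i => Matrix.of fun r c => α⁻¹ * g r (Fin.rev i, c), 1 + D,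
    isUnit_one_add_of_norm_lt_one D (by linarith), ⟨fun s r c => ?_, fun s p c => ?_, hDu⟩, ?_⟩
  · have h1 : shiftSum ((Xh + DX) * (1 + D)) ((Yh + DY) * (1 + D)) (Sum.inl r) (s, c) =
        shiftSum Xt Yt r (s, c) + g r (s, c) := congrFun₂ htop r (s, c)
    have h2 : shiftSum Xt Yt r (s, c) = α * A (Fin.rev s) r c := h.top s r c
    rw [h1, h2]
    simp [mul_add, hα]
  · exact congrFun₂ hD0 p (s, c)
  · rw [famFrob_eq_of_rev, norm_inv, mul_assoc, one_div]
    gcongr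
    have hpen : penFrob (Xt * D + (DXt + DXt * D)) (Yt * D + (DYt + DYt * D)) ≤
        penFrob Xt Yt * ‖D‖ + 3 / 2 * penFrob DX DY := by
      have h1 := penFrob_add_le (Xt * D) (Yt * D) (DXt + DXt * D) (DYt + DYt * D)
      have h2 := penFrob_add_le DXt DYt (DXt * D) (DYt * D)
      have h3 := penFrob_mul_le Xt Yt D
      have h4 := penFrob_mul_le DXt DYt D
      have h5 := mul_le_mul_of_nonneg_left hDh (penFrob_nonneg DXt DYt)
      linarith
    have hDn' : ‖D‖ ≤ Real.sqrt 2 * (K + 1) * (penFrob DX DY / sigmaMin R) := by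
      refine hDn.trans ?_
      gcongr
    have hs2 : Real.sqrt 2 * Real.sqrt 2 = 2 := Real.mul_self_sqrt zero_le_two
    have hs : Real.sqrt 2 ≤ 2 := by nlinarith [Real.sqrt_nonneg 2]
    have hd := penFrob_nonneg DX DY
    calc ‖g‖ ≤ Real.sqrt 2 * (penFrob Xt Yt * ‖D‖ + 3 / 2 * penFrob DX DY) :=
          (norm_shiftSum_le _ _).trans (by gcongr)
      _ ≤ Real.sqrt 2 * (penFrob Xt Yt *
            (Real.sqrt 2 * (K + 1) * (penFrob DX DY / sigmaMin R))) +
            2 * (3 / 2 * penFrob DX DY) := by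
          rw [mul_add]
          have := penFrob_nonneg Xt Yt
          gcongr
      _ = (Real.sqrt 2 * Real.sqrt 2) * (penFrob Xt Yt *
            ((K + 1) * (penFrob DX DY / sigmaMin R))) + 3 * penFrob DX DY := by ring
      _ = _ := by rw [hs2]; ring

end BackwardError

/-- Let `m > n`, `α ≠ 0`, and let
`L̂_t(λ) = λ[[αA_k, X₁₂],[0, −R̃]] + [[Y₁₁, αA₀],[R̃, 0]]` (with
`X₁₂ + Y₁₁ = α[A_{k−1} ⋯ A₁]`, `R̃` nonsingular upper triangular) be a strong
linearization of `P(λ)`, and let `A(λ)` denote its top block. For every pencil `ΔL̂_t`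
with `‖ΔL̂_t‖_F < σ_min(R̃)/(2k^{3/2})`, the pencil `L̂_t + ΔL̂_t` is a strong
linearization of a grade-`k` matrix polynomial `P + ΔP` with
`‖ΔP‖_F/‖P‖_F ≤ Ĉ ‖ΔL̂_t‖_F/‖L̂_t‖_F`, where
`Ĉ = (1/|α|)(‖L̂_t‖_F/‖P‖_F)(3 + 2k‖A‖_F/σ_min(R̃))`; moreover the right minimal
indices of `L̂_t + ΔL̂_t` are those of `P + ΔP` shifted by `k−1` and the left minimal
indices agree, exactly as for `L̂_t` and `P`. -/
theorem statement_18 {F : Type*} [RCLike F] {k m n : ℕ} (hk : 0 < k) (hmn : n < m)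
    (A : Fin (k + 1) → Matrix (Fin m) (Fin n) F)
    (α : F) (hα : α ≠ 0)
    (X12 Y11 : Matrix (Fin m) (Fin (k - 1) × Fin n) F)
    (hXY : ∀ (i : Fin m) (p : Fin (k - 1) × Fin n),
      X12 i p + Y11 i p = α * A (⟨k - 1 - (p.1 : ℕ), by omega⟩) i p.2)
    (R : Matrix (Fin (k - 1) × Fin n) (Fin (k - 1) × Fin n) F) (hR : IsUnit R)
    (hRtri : ∀ p q : Fin (k - 1) × Fin n,
      (q.1 : ℕ) * n + (q.2 : ℕ) < (p.1 : ℕ) * n + (p.2 : ℕ) → R p q = 0)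
    (Xh Yh : Matrix (Fin m ⊕ (Fin (k - 1) × Fin n)) (Fin k × Fin n) F)
    (hXh : Xh = LtX α (A (Fin.last k)) X12 R)
    (hYh : Yh = LtY α (A 0) Y11 R)
    (hlin : IsStrongLin ((k - 1) * n) A (pencil Xh Yh))
    (At Bt : Matrix (Fin m) (Fin k × Fin n) F)
    (hAt : At = Matrix.of fun i q => Xh (Sum.inl i) q)
    (hBt : Bt = Matrix.of fun i q => Yh (Sum.inl i) q)
    (ΔXc ΔYc : Matrix (Fin m ⊕ (Fin (k - 1) × Fin n)) (Fin k × Fin n) F)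
    (hΔ : penFrob ΔXc ΔYc < sigmaMin R / (2 * (k : ℝ) ^ ((3 : ℝ) / 2))) :
    ∃ ΔA : Fin (k + 1) → Matrix (Fin m) (Fin n) F,
      IsStrongLin ((k - 1) * n) (fun i => A i + ΔA i) (pencil (Xh + ΔXc) (Yh + ΔYc)) ∧
      famFrob ΔA / famFrob A ≤
        (1 / ‖α‖ * (penFrob Xh Yh / famFrob A) *
            (3 + 2 * (k : ℝ) * penFrob At Bt / sigmaMin R)) *
          (penFrob ΔXc ΔYc / penFrob Xh Yh) ∧
      (∀ (d : ℕ) (ε : Fin d → ℕ),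
        HasMinIndices (Nr (matPoly fun i => A i + ΔA i)) ε ↔
          HasMinIndices (Nr (pencil (Xh + ΔXc) (Yh + ΔYc))) fun i => ε i + (k - 1)) ∧
      (∀ (d : ℕ) (δ : Fin d → ℕ),
        HasMinIndices (Nl (matPoly fun i => A i + ΔA i)) δ ↔
          HasMinIndices (Nl (pencil (Xh + ΔXc) (Yh + ΔYc))) δ) ∧
      (∀ (d : ℕ) (ε : Fin d → ℕ),
        HasMinIndices (Nr (matPoly A)) ε ↔
          HasMinIndices (Nr (pencil Xh Yh)) fun i => ε i + (k - 1)) ∧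
      (∀ (d : ℕ) (δ : Fin d → ℕ),
        HasMinIndices (Nl (matPoly A)) δ ↔
          HasMinIndices (Nl (pencil Xh Yh)) δ) := by
  obtain ⟨K, rfl⟩ : ∃ K, k = K + 1 := ⟨k - 1, by omega⟩
  subst hXh hYh
  have htrim := isTrim_Lt (K := K) hXY hR
  have hpow : ((K + 1 : ℕ) : ℝ) ^ ((3 : ℝ) / 2) = ((K : ℝ) + 1) * Real.sqrt (K + 1) := by
    have hpos : (0 : ℝ) < (K : ℝ) + 1 := by positivity
    rw [Real.sqrt_eq_rpow, Nat.cast_add_one, show (3 : ℝ) / 2 = 1 + 1 / 2 by norm_num,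
      Real.rpow_add hpos, Real.rpow_one]
  rw [hpow] at hΔ
  have hσ : 0 < sigmaMin R := sigmaMin_pos_of_lt hΔ
  obtain ⟨ΔA, W, hW, hpert, hbound⟩ := htrim.exists_perturbation hα hR LtX_submatrix_inr
    LtY_submatrix_inr ΔXc ΔYc hΔ
  refine ⟨ΔA, hpert.isStrongLin hα hW, ?_, fun _ ε => (hpert.hasMinIndices_iff hα hW ε).1,
    fun _ δ => (hpert.hasMinIndices_iff hα hW δ).2,
    fun _ ε => (htrim.mul_one.hasMinIndices_iff hα isUnit_one ε).1,
    fun _ δ => (htrim.mul_one.hasMinIndices_iff hα isUnit_one δ).2⟩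
  have hL := htrim.penFrob_ne_zero (nonempty_of_sigmaMin_pos R hσ)
  have hcancel (x c d a l : ℝ) (hl : l ≠ 0) : x * c * d / a = x * (l / a) * c * (d / l) := by
    field_simp
  rw [hAt, hBt, Nat.cast_add_one]
  exact (div_le_div_of_nonneg_right hbound (Real.sqrt_nonneg _)).trans_eq
    (hcancel _ _ _ _ _ hL)
end GLin
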